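/- Let p > 1, Θ₀ > 0, T > 0, and let v : ℝ × (0,T) → ℝ be a smooth, strictly positive solution of the nonlocal rescaled equation ∂_τ v = −(1/I_p(v(·,τ))) ∂_y²( v^p ∂_y²(ln_p v) ) + (2p/Θ₀) ∂_y( y v ), such that for every τ the function v(·,τ) is a probability density which, together with all its spatial derivatives, decays faster than any polynomial as |y| → ∞, with I_p(v(·,τ)) > 0 and ∫_ℝ v(·,τ)^p dy ∈ (0,∞). Let B be any fixed probability density with ∫_ℝ B^p dy ∈ (0,∞). Then (d/dτ) [ R_p(B) − R_p(v(·,τ)) ] = −( p / ( ∫_ℝ v(·,τ)^p dy · I_p(v(·,τ)) ) ) · K_p(v(·,τ)) + 2p/Θ₀, where K_p(f) = ∫_ℝ f^p ( d²/dy² (ln_p f) )² dy. -/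

import Mathlib

open MeasureTheory Filter Set

/-- The `p`-logarithm: `ln_p u = (u^(p-1) - 1)/(p-1)` for `p ≠ 1`, and `ln u` for `p = 1`. -/
noncomputable def lnp (p : ℝ) (u : ℝ) : ℝ :=
  if p = 1 then Real.log u else (u ^ (p - 1) - 1) / (p - 1)

/-- Generalized Fisher information `I_p(f) = (1/2) ∫ f ((ln_p f)')²`. -/
noncomputable def fisherP (p : ℝ) (f : ℝ → ℝ) : ℝ :=
  (1 / 2) * ∫ x : ℝ, f x * (deriv (fun y => lnp p (f y)) x) ^ 2

/-- Rényi entropy of order `p ≠ 1`: `R_p(f) = (1/(1-p)) ln ∫ f^p`. -/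
noncomputable def renyi (p : ℝ) (f : ℝ → ℝ) : ℝ :=
  (1 / (1 - p)) * Real.log (∫ x : ℝ, f x ^ p)

/-- `f`, together with all its derivatives, decays faster than any polynomial at infinity. -/
def RapidDecay (f : ℝ → ℝ) : Prop :=
  ∀ n k : ℕ, Tendsto (fun x => x ^ n * iteratedDeriv k f x) (cocompact ℝ) (nhds 0)

/-- Joint smoothness of a function of space and time on the strip `ℝ × s`. -/
def SmoothStrip (s : Set ℝ) (f : ℝ → ℝ → ℝ) : Prop :=
  ContDiffOn ℝ (⊤ : ℕ∞) (Function.uncurry f) (univ ×ˢ s)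

/-- Partial derivative in the first (space) variable. -/
noncomputable def pdy (f : ℝ → ℝ → ℝ) : ℝ → ℝ → ℝ := fun y τ => deriv (fun z => f z τ) y

/-- Partial derivative in the second (time) variable. -/
noncomputable def pdt (f : ℝ → ℝ → ℝ) : ℝ → ℝ → ℝ := fun y τ => deriv (fun s => f y s) τ

namespace SmoothStrip

variable {s : Set ℝ} {f g : ℝ → ℝ → ℝ}

lemma contDiffAt (hs : IsOpen s) (hf : SmoothStrip s f) (y : ℝ) {τ : ℝ} (hτ : τ ∈ s) :
    ContDiffAt ℝ (⊤ : ℕ∞) (Function.uncurry f) (y, τ) :=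
  ContDiffOn.contDiffAt hf ((isOpen_univ.prod hs).mem_nhds ⟨mem_univ _, hτ⟩)

lemma hasFDerivAt (hs : IsOpen s) (hf : SmoothStrip s f) (y : ℝ) {τ : ℝ} (hτ : τ ∈ s) :
    HasFDerivAt (Function.uncurry f) (fderiv ℝ (Function.uncurry f) (y, τ)) (y, τ) :=
  ((hf.contDiffAt hs y hτ).differentiableAt (by simp)).hasFDerivAt

lemma hasDerivAt_fst (hs : IsOpen s) (hf : SmoothStrip s f) (y : ℝ) {τ : ℝ} (hτ : τ ∈ s) :
    HasDerivAt (fun z => f z τ) (fderiv ℝ (Function.uncurry f) (y, τ) (1, 0)) y := by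
  have h1 : HasDerivAt (fun z : ℝ => (z, τ)) ((1 : ℝ), (0 : ℝ)) y :=
    (hasDerivAt_id y).prodMk (hasDerivAt_const y τ)
  exact (hf.hasFDerivAt hs y hτ).comp_hasDerivAt y h1

lemma hasDerivAt_snd (hs : IsOpen s) (hf : SmoothStrip s f) (y : ℝ) {τ : ℝ} (hτ : τ ∈ s) :
    HasDerivAt (fun t => f y t) (fderiv ℝ (Function.uncurry f) (y, τ) (0, 1)) τ := by
  have h1 : HasDerivAt (fun t : ℝ => (y, t)) ((0 : ℝ), (1 : ℝ)) τ :=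
    (hasDerivAt_const τ y).prodMk (hasDerivAt_id τ)
  exact (hf.hasFDerivAt hs y hτ).comp_hasDerivAt τ h1

lemma hasDerivAt_pdy (hs : IsOpen s) (hf : SmoothStrip s f) (y : ℝ) {τ : ℝ} (hτ : τ ∈ s) :
    HasDerivAt (fun z => f z τ) (pdy f y τ) y :=
  (hf.hasDerivAt_fst hs y hτ).differentiableAt.hasDerivAt

lemma hasDerivAt_pdt (hs : IsOpen s) (hf : SmoothStrip s f) (y : ℝ) {τ : ℝ} (hτ : τ ∈ s) :
    HasDerivAt (fun t => f y t) (pdt f y τ) τ :=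
  (hf.hasDerivAt_snd hs y hτ).differentiableAt.hasDerivAt

lemma fderiv_apply (hs : IsOpen s) (hf : SmoothStrip s f) (e : ℝ × ℝ) :
    ContDiffOn ℝ (⊤ : ℕ∞) (fun x => fderiv ℝ (Function.uncurry f) x e) (univ ×ˢ s) :=
  (ContDiffOn.fderiv_of_isOpen hf (isOpen_univ.prod hs) (by simp)).clm_apply contDiffOn_const

protected lemma pdy (hs : IsOpen s) (hf : SmoothStrip s f) : SmoothStrip s (pdy f) :=
  (hf.fderiv_apply hs (1, 0)).congr fun x hx => (hf.hasDerivAt_fst hs x.1 hx.2).deriv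

protected lemma pdt (hs : IsOpen s) (hf : SmoothStrip s f) : SmoothStrip s (pdt f) :=
  (hf.fderiv_apply hs (0, 1)).congr fun x hx => (hf.hasDerivAt_snd hs x.1 hx.2).deriv

lemma pdt_pdy (hs : IsOpen s) (hf : SmoothStrip s f) (y : ℝ) {τ : ℝ} (hτ : τ ∈ s) :
    pdt (pdy f) y τ = pdy (pdt f) y τ := by
  have hsym : IsSymmSndFDerivAt ℝ (Function.uncurry f) (y, τ) :=
    (hf.contDiffAt hs y hτ).isSymmSndFDerivAt (by
      simpa using WithTop.coe_le_coe.2 (le_top : (2 : ℕ∞) ≤ ⊤))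
  have hd : HasFDerivAt (fderiv ℝ (Function.uncurry f))
      (fderiv ℝ (fderiv ℝ (Function.uncurry f)) (y, τ)) (y, τ) := by
    have : ContDiffAt ℝ (⊤ : ℕ∞) (fderiv ℝ (Function.uncurry f)) (y, τ) :=
      (hf.contDiffAt hs y hτ).fderiv_right (by simp)
    exact (this.differentiableAt (by simp)).hasFDerivAt
  have he (e : ℝ × ℝ) : HasFDerivAt (fun x => fderiv ℝ (Function.uncurry f) x e)
      ((ContinuousLinearMap.apply ℝ ℝ e).comp
        (fderiv ℝ (fderiv ℝ (Function.uncurry f)) (y, τ))) (y, τ) :=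
    (ContinuousLinearMap.apply ℝ ℝ e).hasFDerivAt.comp (y, τ) hd
  have h1 : HasDerivAt (fun t => pdy f y t)
      (fderiv ℝ (fderiv ℝ (Function.uncurry f)) (y, τ) (0, 1) (1, 0)) τ := by
    have hc : HasDerivAt (fun t : ℝ => (y, t)) ((0 : ℝ), (1 : ℝ)) τ :=
      (hasDerivAt_const τ y).prodMk (hasDerivAt_id τ)
    refine ((he (1, 0)).comp_hasDerivAt τ hc).congr_of_eventuallyEq ?_
    filter_upwards [hs.mem_nhds hτ] with t ht using (hf.hasDerivAt_fst hs y ht).deriv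
  have h2 : HasDerivAt (fun z => pdt f z τ)
      (fderiv ℝ (fderiv ℝ (Function.uncurry f)) (y, τ) (1, 0) (0, 1)) y := by
    have hc : HasDerivAt (fun z : ℝ => (z, τ)) ((1 : ℝ), (0 : ℝ)) y :=
      (hasDerivAt_id y).prodMk (hasDerivAt_const y τ)
    refine ((he (0, 1)).comp_hasDerivAt y hc).congr_of_eventuallyEq ?_
    exact Eventually.of_forall fun t => (hf.hasDerivAt_snd hs t hτ).deriv
  change deriv (fun t => pdy f y t) τ = deriv (fun z => pdt f z τ) y
  rw [h1.deriv, h2.deriv]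
  exact hsym _ _

lemma continuousOn (hf : SmoothStrip s f) : ContinuousOn (Function.uncurry f) (univ ×ˢ s) :=
  ContDiffOn.continuousOn hf

lemma continuous_fst (hf : SmoothStrip s f) {τ : ℝ} (hτ : τ ∈ s) :
    Continuous (fun y => f y τ) :=
  hf.continuousOn.comp_continuous (f := fun y : ℝ => (y, τ)) (by fun_prop)
    fun y => ⟨mem_univ _, hτ⟩

lemma mul (hf : SmoothStrip s f) (hg : SmoothStrip s g) :
    SmoothStrip s (fun y τ => f y τ * g y τ) :=
  ContDiffOn.mul hf hg

lemma add (hf : SmoothStrip s f) (hg : SmoothStrip s g) :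
    SmoothStrip s (fun y τ => f y τ + g y τ) :=
  ContDiffOn.add hf hg

lemma rpow_const (hf : SmoothStrip s f) (h0 : ∀ y, ∀ τ ∈ s, 0 < f y τ) (a : ℝ) :
    SmoothStrip s (fun y τ => f y τ ^ a) :=
  ContDiffOn.rpow_const_of_ne hf fun x hx => (h0 x.1 x.2 hx.2).ne'

lemma of_fst {φ : ℝ → ℝ} (hφ : ContDiff ℝ (⊤ : ℕ∞) φ) : SmoothStrip s (fun y _ => φ y) :=
  (hφ.comp contDiff_fst).contDiffOn

/-- Differentiation under the integral sign, for an integrand supported in a fixed compact set. -/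
lemma hasDerivAt_integral (hs : IsOpen s) (hf : SmoothStrip s f) {k : Set ℝ} (hk : IsCompact k)
    (h0 : ∀ y, y ∉ k → ∀ τ, f y τ = 0) {τ : ℝ} (hτ : τ ∈ s) :
    HasDerivAt (fun t => ∫ y, f y t) (∫ y, pdt f y τ) τ := by
  obtain ⟨δ, hδ, hball⟩ := Metric.nhds_basis_closedBall.mem_iff.1 (hs.mem_nhds hτ)
  have hcpt : IsCompact (k ×ˢ Metric.closedBall τ δ) := hk.prod (isCompact_closedBall τ δ)
  have hsub : k ×ˢ Metric.closedBall τ δ ⊆ univ ×ˢ s := prod_mono (subset_univ _) hball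
  obtain ⟨C, hC⟩ := hcpt.exists_bound_of_continuousOn ((hf.pdt hs).continuousOn.mono hsub)
  have hz : ∀ y, y ∉ k → ∀ t, pdt f y t = 0 := by
    intro y hy t
    have : (fun r => f y r) = fun _ => 0 := funext (h0 y hy)
    simp [pdt, this]
  have hmeas : ∀ t ∈ s, Integrable (fun y => f y t) := fun t ht =>
    (hf.continuous_fst ht).integrable_of_hasCompactSupport
      (HasCompactSupport.intro hk fun y hy => h0 y hy t)
  refine (hasDerivAt_integral_of_dominated_loc_of_deriv_le (F := fun t y => f y t)
    (F' := fun t y => pdt f y t) (bound := k.indicator fun _ => C)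
    (Metric.closedBall_mem_nhds τ hδ) ?_ (hmeas τ hτ) ?_ ?_ ?_ ?_).2
  · filter_upwards [hs.mem_nhds hτ] with t ht using (hmeas t ht).aestronglyMeasurable
  · exact ((hf.pdt hs).continuous_fst hτ).aestronglyMeasurable
  · refine Eventually.of_forall fun y t ht => ?_
    by_cases hy : y ∈ k
    · simpa [hy] using hC (y, t) ⟨hy, ht⟩
    · simp [hy, hz y hy]
  · exact (integrable_indicator_iff hk.measurableSet).2
      (integrableOn_const hk.measure_ne_top)
  · exact Eventually.of_forall fun y t ht => hf.hasDerivAt_pdt hs y (hball ht)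

lemma continuousOn_integral (hs : IsOpen s) (hf : SmoothStrip s f) {k : Set ℝ}
    (hk : IsCompact k) (h0 : ∀ y, y ∉ k → ∀ τ, f y τ = 0) :
    ContinuousOn (fun t => ∫ y, f y t) s :=
  fun _ ht => (hf.hasDerivAt_integral hs hk h0 ht).continuousAt.continuousWithinAt

end SmoothStrip

/-- A positive density `v` at a fixed time with `w = v ^ (p - 1)`, `L = (ln_p v)'` and the next two
derivatives `L₂`, `L₃` of `L`, encoded by the differential relations between them. -/
structure PressureProfile (p : ℝ) (v w L L₂ L₃ : ℝ → ℝ) : Prop where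
  one_lt : 1 < p
  v_pos : ∀ y, 0 < v y
  w_pos : ∀ y, 0 < w y
  hasDerivAt_v : ∀ y, HasDerivAt v (v y * L y / w y) y
  hasDerivAt_w : ∀ y, HasDerivAt w ((p - 1) * L y) y
  hasDerivAt_L : ∀ y, HasDerivAt L (L₂ y) y
  hasDerivAt_L₂ : ∀ y, HasDerivAt L₂ (L₃ y) y
  continuous_L₃ : Continuous L₃

/-- A cutoff at scale `1 / ρ`: `χ' = ρ e₁` and `e₁' = ρ e₂`, with `e₁`, `e₂` bounded by `B`. -/
structure ScaledCutoff (B ρ : ℝ) (χ e₁ e₂ : ℝ → ℝ) : Prop where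
  one_le : 1 ≤ B
  pos : 0 < ρ
  le_quarter : ρ ≤ 1 / 4
  hasDerivAt : ∀ y, HasDerivAt χ (ρ * e₁ y) y
  hasDerivAt_e₁ : ∀ y, HasDerivAt e₁ (ρ * e₂ y) y
  continuous_e₂ : Continuous e₂
  nonneg : ∀ y, 0 ≤ χ y
  le_one : ∀ y, χ y ≤ 1
  abs_e₁ : ∀ y, |e₁ y| ≤ B
  abs_e₂ : ∀ y, |e₂ y| ≤ B
  eq_zero : ∀ y, 2 < |ρ * y| → χ y = 0
  e₁_eq_zero : ∀ y, |ρ * y| < 1 → e₁ y = 0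

lemma integral_lin_three {f g h : ℝ → ℝ} (hf : Integrable f) (hg : Integrable g)
    (hh : Integrable h) (a b d : ℝ) :
    ∫ y, (a * f y + b * g y + d * h y) = a * (∫ y, f y) + b * (∫ y, g y) + d * ∫ y, h y := by
  have hfg : Integrable fun y => a * f y + b * g y := (hf.const_mul a).add (hg.const_mul b)
  rw [integral_add hfg (hh.const_mul d), integral_add (hf.const_mul a) (hg.const_mul b)]
  simp only [integral_const_mul]

lemma integral_lin_two {f g : ℝ → ℝ} (hf : Integrable f) (hg : Integrable g) (a b : ℝ) :
    ∫ y, (a * f y + b * g y) = a * (∫ y, f y) + b * ∫ y, g y := by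
  rw [integral_add (hf.const_mul a) (hg.const_mul b)]
  simp only [integral_const_mul]

lemma abs_integral_le_lin_three {F f g h : ℝ → ℝ} (hf : Integrable f) (hg : Integrable g)
    (hh : Integrable h) (a b d : ℝ) (hF : ∀ y, |F y| ≤ a * f y + b * g y + d * h y) :
    |∫ y, F y| ≤ a * (∫ y, f y) + b * (∫ y, g y) + d * ∫ y, h y := by
  rw [← integral_lin_three hf hg hh]
  have hfgh : Integrable fun y => a * f y + b * g y + d * h y :=
    ((hf.const_mul a).add (hg.const_mul b)).add (hh.const_mul d)
  rw [← Real.norm_eq_abs]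
  exact norm_integral_le_of_norm_le hfgh (Eventually.of_forall fun y => by
    simpa only [Real.norm_eq_abs] using hF y)

lemma two_mul_abs_le (a b : ℝ) : 2 * |a * b| ≤ a ^ 2 + b ^ 2 := by
  rw [abs_mul, ← sq_abs a, ← sq_abs b]
  nlinarith [sq_nonneg (|a| - |b|)]

namespace ScaledCutoff

variable {B ρ : ℝ} {χ e₁ e₂ : ℝ → ℝ} (hχ : ScaledCutoff B ρ χ e₁ e₂)
include hχ

lemma hasDerivAt_pow_four (y : ℝ) :
    HasDerivAt (fun z => χ z ^ 4) (4 * χ y ^ 3 * (ρ * e₁ y)) y := by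
  simpa using (hχ.hasDerivAt y).fun_pow 4

lemma hasDerivAt_pow_three (y : ℝ) :
    HasDerivAt (fun z => χ z ^ 3) (3 * χ y ^ 2 * (ρ * e₁ y)) y := by
  simpa using (hχ.hasDerivAt y).fun_pow 3

lemma hasDerivAt_pow_two (y : ℝ) :
    HasDerivAt (fun z => χ z ^ 2) (2 * χ y * (ρ * e₁ y)) y := by
  simpa using (hχ.hasDerivAt y).fun_pow 2

lemma continuous : Continuous χ :=
  continuous_iff_continuousAt.2 fun y => (hχ.hasDerivAt y).continuousAt

lemma continuous_e₁ : Continuous e₁ :=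
  continuous_iff_continuousAt.2 fun y => (hχ.hasDerivAt_e₁ y).continuousAt

lemma eq_zero_of_notMem (y : ℝ) (hy : y ∉ Icc (-(2 / ρ)) (2 / ρ)) : χ y = 0 := by
  refine hχ.eq_zero y ?_
  by_contra! h
  refine hy (abs_le.1 ?_)
  rw [abs_mul, abs_of_pos hχ.pos] at h
  rwa [le_div_iff₀ hχ.pos, mul_comm]

lemma hasCompactSupport {f : ℝ → ℝ} (h0 : ∀ y, χ y = 0 → f y = 0) : HasCompactSupport f :=
  HasCompactSupport.intro isCompact_Icc fun y hy => h0 y (hχ.eq_zero_of_notMem y hy)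

lemma integrable {f : ℝ → ℝ} (hf : Continuous f) (h0 : ∀ y, χ y = 0 → f y = 0) :
    Integrable f :=
  hf.integrable_of_hasCompactSupport (hχ.hasCompactSupport h0)

lemma integral_deriv_eq_zero {f f' : ℝ → ℝ} (hd : ∀ y, HasDerivAt f (f' y) y)
    (hc : Continuous f') (h0 : ∀ y, χ y = 0 → f y = 0) : ∫ y, f' y = 0 := by
  have hcs := hχ.hasCompactSupport h0
  have hf' : f' = deriv f := funext fun y => (hd y).deriv.symm
  refine integral_eq_zero_of_hasDerivAt_of_integrable hd
    (hc.integrable_of_hasCompactSupport (hf' ▸ hcs.deriv)) ?_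
  exact (continuous_iff_continuousAt.2 fun y => (hd y).continuousAt).integrable_of_hasCompactSupport
    hcs

lemma sq_e₁_le (y : ℝ) : e₁ y ^ 2 ≤ B ^ 2 := sq_le_sq' (abs_le.1 (hχ.abs_e₁ y)).1
  (abs_le.1 (hχ.abs_e₁ y)).2

lemma pow_four_le_one (y : ℝ) : χ y ^ 4 ≤ 1 := pow_le_one₀ (hχ.nonneg y) (hχ.le_one y)

lemma second_sq_le (y : ℝ) : (12 * e₁ y ^ 2 + 4 * χ y * e₂ y) ^ 2 ≤ 256 * B ^ 4 := by
  have h1 := hχ.sq_e₁_le y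
  have h2 := abs_le.1 (hχ.abs_e₂ y)
  have h3 := hχ.nonneg y
  have h4 := hχ.le_one y
  have hB := hχ.one_le
  have h5 : |12 * e₁ y ^ 2 + 4 * χ y * e₂ y| ≤ 16 * B ^ 2 := by
    rw [abs_le]
    constructor <;> nlinarith [sq_nonneg (e₁ y)]
  calc _ = |12 * e₁ y ^ 2 + 4 * χ y * e₂ y| ^ 2 := (sq_abs _).symm
    _ ≤ (16 * B ^ 2) ^ 2 := by gcongr
    _ = _ := by ring

lemma abs_first_moment_le (y : ℝ) : |ρ * y * χ y ^ 3 * e₁ y| ≤ 2 * B := by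
  have hB := hχ.one_le
  by_cases h : 2 < |ρ * y|
  · simp [hχ.eq_zero y h]; linarith
  · push Not at h
    rw [abs_mul, abs_mul]
    have h1 : |χ y ^ 3| ≤ 1 := by
      rw [abs_of_nonneg (pow_nonneg (hχ.nonneg y) 3)]
      exact pow_le_one₀ (hχ.nonneg y) (hχ.le_one y)
    calc _ ≤ 2 * 1 * B := by gcongr; exact hχ.abs_e₁ y
      _ = _ := by ring

end ScaledCutoff

namespace PressureProfile

variable {p B ρ W : ℝ} {v w L L₂ L₃ χ e₁ e₂ : ℝ → ℝ}

lemma continuous_v (h : PressureProfile p v w L L₂ L₃) : Continuous v :=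
  continuous_iff_continuousAt.2 fun y => (h.hasDerivAt_v y).continuousAt

lemma continuous_w (h : PressureProfile p v w L L₂ L₃) : Continuous w :=
  continuous_iff_continuousAt.2 fun y => (h.hasDerivAt_w y).continuousAt

lemma continuous_L (h : PressureProfile p v w L L₂ L₃) : Continuous L :=
  continuous_iff_continuousAt.2 fun y => (h.hasDerivAt_L y).continuousAt

lemma continuous_L₂ (h : PressureProfile p v w L L₂ L₃) : Continuous L₂ :=
  continuous_iff_continuousAt.2 fun y => (h.hasDerivAt_L₂ y).continuousAt

lemma integral_entropy_flux (h : PressureProfile p v w L L₂ L₃)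
    (hχ : ScaledCutoff B ρ χ e₁ e₂) {G₂ : ℝ → ℝ} (hG₂ : Continuous G₂)
    (hG : ∀ y, HasDerivAt (fun z => v z * (p * L z * L₂ z + w z * L₃ z)) (G₂ y) y) :
    ∫ y, w y * G₂ y * χ y ^ 4 =
      (p - 1) * (∫ y, v y * w y * L₂ y ^ 2 * χ y ^ 4) +
      ∫ y, (8 * (p - 1) * ρ * (v y * w y * (L₂ y * χ y ^ 2) * (L y * χ y * e₁ y)) +
        ρ ^ 2 * (v y * w y ^ 2 * (L₂ y * χ y ^ 2) * (12 * e₁ y ^ 2 + 4 * χ y * e₂ y))) := by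
  have cv := h.continuous_v
  have cw := h.continuous_w
  have cL := h.continuous_L
  have cL₂ := h.continuous_L₂
  have cL₃ := h.continuous_L₃
  have cχ := hχ.continuous
  have ce₁ := hχ.continuous_e₁
  have ce₂ := hχ.continuous_e₂
  have key := hχ.integral_deriv_eq_zero
    (f := fun y => w y * χ y ^ 4 * (v y * (p * L y * L₂ y + w y * L₃ y)) -
      ((p - 1) * L y * χ y ^ 4 + w y * (4 * χ y ^ 3 * (ρ * e₁ y))) * (v y * w y * L₂ y))
    (f' := fun y => w y * G₂ y * χ y ^ 4 - ((p - 1) * (v y * w y * L₂ y ^ 2 * χ y ^ 4) +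
      (8 * (p - 1) * ρ * (v y * w y * (L₂ y * χ y ^ 2) * (L y * χ y * e₁ y)) +
        ρ ^ 2 * (v y * w y ^ 2 * (L₂ y * χ y ^ 2) * (12 * e₁ y ^ 2 + 4 * χ y * e₂ y)))))
    (fun y => by
      have hw := (h.w_pos y).ne'
      refine ((((h.hasDerivAt_w y).mul (hχ.hasDerivAt_pow_four y)).mul (hG y)).sub
        (((((h.hasDerivAt_L y).const_mul (p - 1)).mul (hχ.hasDerivAt_pow_four y)).add
          ((h.hasDerivAt_w y).mul (((hχ.hasDerivAt_pow_three y).const_mul 4).mul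
            ((hχ.hasDerivAt_e₁ y).const_mul ρ)))).mul
          (((h.hasDerivAt_v y).mul (h.hasDerivAt_w y)).mul (h.hasDerivAt_L₂ y)))).congr_deriv ?_
      simp only [Pi.mul_apply, Pi.add_apply]
      field_simp
      ring)
    (by fun_prop) (fun y hy => by simp [hy])
  rw [integral_sub, integral_add, integral_const_mul] at key
  · linarith
  · exact hχ.integrable (by fun_prop) (fun y hy => by simp [hy])
  · exact hχ.integrable (by fun_prop) (fun y hy => by simp [hy])
  · exact hχ.integrable (by fun_prop) (fun y hy => by simp [hy])
  · exact hχ.integrable (by fun_prop) (fun y hy => by simp [hy])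

lemma abs_entropy_flux_error_le (h : PressureProfile p v w L L₂ L₃)
    (hχ : ScaledCutoff B ρ χ e₁ e₂) (hW : ∀ y, w y ≤ W) (iv : Integrable v)
    (iL : Integrable fun y => v y * L y ^ 2) :
    |∫ y, (8 * (p - 1) * ρ * (v y * w y * (L₂ y * χ y ^ 2) * (L y * χ y * e₁ y)) +
        ρ ^ 2 * (v y * w y ^ 2 * (L₂ y * χ y ^ 2) * (12 * e₁ y ^ 2 + 4 * χ y * e₂ y)))| ≤
      ρ * ((4 * p) * (∫ y, v y * w y * L₂ y ^ 2 * χ y ^ 4) +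
        (4 * p * B ^ 2 * W) * (∫ y, v y * L y ^ 2) + (128 * B ^ 4 * W ^ 3) * ∫ y, v y) := by
  have cv := h.continuous_v
  have cw := h.continuous_w
  have cL := h.continuous_L
  have cL₂ := h.continuous_L₂
  have cχ := hχ.continuous
  refine (abs_integral_le_lin_three (f := fun y => v y * w y * L₂ y ^ 2 * χ y ^ 4)
    (hχ.integrable (by fun_prop) (fun y hy => by simp [hy])) iL iv (ρ * (4 * p))
    (ρ * (4 * p * B ^ 2 * W)) (ρ * (128 * B ^ 4 * W ^ 3)) fun y => ?_).trans_eq (by ring)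
  have hp := h.one_lt
  have hv := h.v_pos y
  have hw := h.w_pos y
  have hWy := hW y
  have hρ := hχ.pos
  have hρ4 := hχ.le_quarter
  have hB := hχ.one_le
  set a := L₂ y * χ y ^ 2 with ha
  set b := L y * χ y * e₁ y with hb
  set t := 12 * e₁ y ^ 2 + 4 * χ y * e₂ y with ht
  have htB : t ^ 2 ≤ 256 * B ^ 4 := hχ.second_sq_le y
  have hbB : b ^ 2 ≤ L y ^ 2 * B ^ 2 := by
    have h1 := hχ.sq_e₁_le y
    have h2 : χ y ^ 2 ≤ 1 := pow_le_one₀ (hχ.nonneg y) (hχ.le_one y)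
    calc b ^ 2 = L y ^ 2 * (χ y ^ 2 * e₁ y ^ 2) := by rw [hb]; ring
      _ ≤ L y ^ 2 * (1 * B ^ 2) := by gcongr
      _ = _ := by ring
  have haa : v y * w y * L₂ y ^ 2 * χ y ^ 4 = v y * w y * a ^ 2 := by rw [ha]; ring
  rw [haa]
  have e1 : |8 * (p - 1) * ρ * (v y * w y * a * b)| ≤
      4 * (p - 1) * ρ * (v y * w y) * (a ^ 2 + L y ^ 2 * B ^ 2) := by
    have : 8 * (p - 1) * ρ * (v y * w y * a * b) = 8 * (p - 1) * ρ * (v y * w y) * (a * b) := by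
      ring
    rw [this, abs_mul, abs_of_nonneg (by have := sub_pos.2 hp; positivity)]
    have hc : 0 ≤ 4 * (p - 1) * ρ * (v y * w y) := by have := sub_pos.2 hp; positivity
    nlinarith [mul_le_mul_of_nonneg_left ((two_mul_abs_le a b).trans (add_le_add_right hbB _)) hc]
  have e2 : |ρ ^ 2 * (v y * w y ^ 2 * a * t)| ≤
      ρ * (1 / 2) * (v y * w y) * (a ^ 2 + w y ^ 2 * (256 * B ^ 4)) := by
    have : ρ ^ 2 * (v y * w y ^ 2 * a * t) = ρ ^ 2 * (v y * w y) * (a * (w y * t)) := by ring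
    rw [this, abs_mul, abs_of_nonneg (by positivity)]
    have h1 : 2 * |a * (w y * t)| ≤ a ^ 2 + w y ^ 2 * (256 * B ^ 4) := by
      refine (two_mul_abs_le _ _).trans ?_
      rw [mul_pow (w y) t]
      exact add_le_add_right (mul_le_mul_of_nonneg_left htB (sq_nonneg _)) _
    have h2 : ρ ^ 2 ≤ ρ := by nlinarith
    calc ρ ^ 2 * (v y * w y) * |a * (w y * t)| ≤ ρ * (v y * w y) * |a * (w y * t)| := by gcongr
      _ = ρ * (1 / 2) * (v y * w y) * (2 * |a * (w y * t)|) := by ring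
      _ ≤ _ := by gcongr
  have e3 : v y * w y * (L y ^ 2 * B ^ 2) ≤ B ^ 2 * W * (v y * L y ^ 2) := by
    calc v y * w y * (L y ^ 2 * B ^ 2) ≤ v y * W * (L y ^ 2 * B ^ 2) := by gcongr
      _ = _ := by ring
  have e4 : v y * w y * (w y ^ 2 * (256 * B ^ 4)) ≤ 256 * B ^ 4 * W ^ 3 * v y := by
    calc v y * w y * (w y ^ 2 * (256 * B ^ 4)) = v y * w y ^ 3 * (256 * B ^ 4) := by ring
      _ ≤ v y * W ^ 3 * (256 * B ^ 4) := by gcongr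
      _ = _ := by ring
  have e5 : 0 ≤ v y * w y * a ^ 2 := by positivity
  have e6 : 0 ≤ B ^ 2 * W * (v y * L y ^ 2) := by
    have := hw.trans_le hWy
    positivity
  calc _ ≤ 4 * (p - 1) * ρ * (v y * w y) * (a ^ 2 + L y ^ 2 * B ^ 2) +
        ρ * (1 / 2) * (v y * w y) * (a ^ 2 + w y ^ 2 * (256 * B ^ 4)) :=
        (abs_add_le _ _).trans (add_le_add e1 e2)
    _ = ρ * (4 * (p - 1) * (v y * w y * a ^ 2) + 4 * (p - 1) * (v y * w y * (L y ^ 2 * B ^ 2)) +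
        (1 / 2) * (v y * w y * a ^ 2) + (1 / 2) * (v y * w y * (w y ^ 2 * (256 * B ^ 4)))) := by
        ring
    _ ≤ ρ * (4 * (p - 1) * (v y * w y * a ^ 2) + 4 * (p - 1) * (B ^ 2 * W * (v y * L y ^ 2)) +
        (1 / 2) * (v y * w y * a ^ 2) + (1 / 2) * (256 * B ^ 4 * W ^ 3 * v y)) := by
        have := sub_pos.2 hp
        gcongr
    _ ≤ ρ * (4 * p * (v y * w y * a ^ 2) + 4 * p * (B ^ 2 * W * (v y * L y ^ 2)) +
        128 * B ^ 4 * W ^ 3 * v y) := by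
        gcongr ρ * ?_
        linarith
    _ = _ := by ring

lemma integral_entropy_drift (h : PressureProfile p v w L L₂ L₃)
    (hχ : ScaledCutoff B ρ χ e₁ e₂) :
    ∫ y, p * w y * (v y + y * (v y * L y / w y)) * χ y ^ 4 =
      (p - 1) * (∫ y, v y * w y * χ y ^ 4) -
      4 * ∫ y, v y * w y * (ρ * y * χ y ^ 3 * e₁ y) := by
  have cv := h.continuous_v
  have cw := h.continuous_w
  have cL := h.continuous_L
  have cχ := hχ.continuous
  have ce₁ := hχ.continuous_e₁
  have hw0 : ∀ y, w y ≠ 0 := fun y => (h.w_pos y).ne'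
  have key := hχ.integral_deriv_eq_zero (f := fun y => y * (v y * w y) * χ y ^ 4)
    (f' := fun y => p * w y * (v y + y * (v y * L y / w y)) * χ y ^ 4 -
      ((p - 1) * (v y * w y * χ y ^ 4) + (-4) * (v y * w y * (ρ * y * χ y ^ 3 * e₁ y))))
    (fun y => by
      have hw := (h.w_pos y).ne'
      refine (((hasDerivAt_id y).mul ((h.hasDerivAt_v y).mul
        (h.hasDerivAt_w y))).mul (hχ.hasDerivAt_pow_four y)).congr_deriv ?_
      simp only [Pi.mul_apply, id]
      field_simp
      ring)
    (by fun_prop (disch := assumption)) (fun y hy => by simp [hy])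
  rw [integral_sub, integral_lin_two] at key
  · linarith
  · exact hχ.integrable (by fun_prop) (fun y hy => by simp [hy])
  · exact hχ.integrable (by fun_prop) (fun y hy => by simp [hy])
  · exact hχ.integrable (by fun_prop (disch := assumption)) (fun y hy => by simp [hy])
  · exact hχ.integrable (by fun_prop) (fun y hy => by simp [hy])

lemma integral_hessian (h : PressureProfile p v w L L₂ L₃)
    (hχ : ScaledCutoff B ρ χ e₁ e₂) {ψ ψ₁ : ℝ → ℝ} (hψ : ∀ y, HasDerivAt ψ (ψ₁ y) y)
    (cψ₁ : Continuous ψ₁) (hψ0 : ∀ y, χ y = 0 → ψ y = 0 ∧ ψ₁ y = 0) :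
    ∫ y, v y * w y * L₂ y ^ 2 * ψ y =
      ∫ y, (-(v y * L y * (p * L y * L₂ y + w y * L₃ y) * ψ y) -
        v y * w y * L y * L₂ y * ψ₁ y) := by
  have cv := h.continuous_v
  have cw := h.continuous_w
  have cL := h.continuous_L
  have cL₂ := h.continuous_L₂
  have cL₃ := h.continuous_L₃
  have cψ : Continuous ψ := continuous_iff_continuousAt.2 fun y => (hψ y).continuousAt
  have key := hχ.integral_deriv_eq_zero (f := fun y => L y * (v y * w y * L₂ y) * ψ y)
    (f' := fun y => v y * w y * L₂ y ^ 2 * ψ y -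
      (-(v y * L y * (p * L y * L₂ y + w y * L₃ y) * ψ y) - v y * w y * L y * L₂ y * ψ₁ y))
    (fun y => by
      have hw := (h.w_pos y).ne'
      refine (((h.hasDerivAt_L y).mul (((h.hasDerivAt_v y).mul (h.hasDerivAt_w y)).mul
        (h.hasDerivAt_L₂ y))).mul (hψ y)).congr_deriv ?_
      simp only [Pi.mul_apply]
      field_simp
      ring)
    (by fun_prop) (fun y hy => by simp [hψ0 y hy])
  rw [integral_sub] at key
  · linarith
  · exact hχ.integrable (by fun_prop) (fun y hy => by simp [hψ0 y hy])
  · exact hχ.integrable (by fun_prop) (fun y hy => by simp [hψ0 y hy])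

end PressureProfile

namespace PressureProfile

variable {p B ρ W : ℝ} {v w L L₂ L₃ χ e₁ e₂ : ℝ → ℝ}

lemma abs_hessian_cutoff_error_le (h : PressureProfile p v w L L₂ L₃)
    (hχ : ScaledCutoff B ρ χ e₁ e₂) (hW : ∀ y, w y ≤ W) (y : ℝ) :
    |v y * w y * L y * L₂ y * (4 * χ y ^ 3 * (ρ * e₁ y))| ≤
      2 * ρ * (v y * w y * L₂ y ^ 2 * χ y ^ 4) + 2 * ρ * B ^ 2 * W * (v y * L y ^ 2) := by
  have hv := h.v_pos y
  have hw := h.w_pos y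
  have hWy := hW y
  have hρ := hχ.pos
  have hbB : (L y * χ y * e₁ y) ^ 2 ≤ L y ^ 2 * B ^ 2 := by
    have h1 := hχ.sq_e₁_le y
    have h2 : χ y ^ 2 ≤ 1 := pow_le_one₀ (hχ.nonneg y) (hχ.le_one y)
    calc _ = L y ^ 2 * (χ y ^ 2 * e₁ y ^ 2) := by ring
      _ ≤ L y ^ 2 * (1 * B ^ 2) := by gcongr
      _ = _ := by ring
  have : v y * w y * L y * L₂ y * (4 * χ y ^ 3 * (ρ * e₁ y)) =
      2 * ρ * (v y * w y) * (2 * ((L₂ y * χ y ^ 2) * (L y * χ y * e₁ y))) := by ring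
  rw [this, abs_mul, abs_of_nonneg (by positivity), abs_mul, abs_two]
  calc _ ≤ 2 * ρ * (v y * w y) * ((L₂ y * χ y ^ 2) ^ 2 + L y ^ 2 * B ^ 2) := by
        gcongr
        exact (two_mul_abs_le _ _).trans (add_le_add_right hbB _)
    _ = 2 * ρ * (v y * w y * L₂ y ^ 2 * χ y ^ 4) + 2 * ρ * B ^ 2 * w y * (v y * L y ^ 2) := by
        ring
    _ ≤ _ := by gcongr

lemma integral_hessian_le (h : PressureProfile p v w L L₂ L₃)
    (hχ : ScaledCutoff B ρ χ e₁ e₂) (hW : ∀ y, w y ≤ W) (iL : Integrable fun y => v y * L y ^ 2) :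
    ∫ y, v y * w y * L₂ y ^ 2 * χ y ^ 4 ≤
      (∫ y, v y * (p * L y * L₂ y + w y * L₃ y) ^ 2 * χ y ^ 4) +
        (1 + 4 * B ^ 2 * W) * ∫ y, v y * L y ^ 2 := by
  have cv := h.continuous_v
  have cw := h.continuous_w
  have cL := h.continuous_L
  have cL₂ := h.continuous_L₂
  have cL₃ := h.continuous_L₃
  have cχ := hχ.continuous
  have ce₁ := hχ.continuous_e₁
  have iK : Integrable fun y => v y * w y * L₂ y ^ 2 * χ y ^ 4 :=
    hχ.integrable (by fun_prop) (fun y hy => by simp [hy])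
  have iD : Integrable fun y => v y * (p * L y * L₂ y + w y * L₃ y) ^ 2 * χ y ^ 4 :=
    hχ.integrable (by fun_prop) (fun y hy => by simp [hy])
  have hW0 : 0 ≤ W := (h.w_pos 0).le.trans (hW 0)
  have key := (h.integral_hessian hχ hχ.hasDerivAt_pow_four (by fun_prop)
    (fun y hy => by simp [hy])).le.trans ((le_abs_self _).trans
    (abs_integral_le_lin_three iD iK iL (1 / 2) (2 * ρ) (1 / 2 + 2 * ρ * B ^ 2 * W) fun y => ?_))
  · have hK0 : 0 ≤ ∫ y, v y * w y * L₂ y ^ 2 * χ y ^ 4 := integral_nonneg fun y => by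
      have := h.v_pos y
      have := h.w_pos y
      dsimp only
      positivity
    have hJ0 : 0 ≤ ∫ y, v y * L y ^ 2 := integral_nonneg fun y => by
      have := h.v_pos y
      dsimp only
      positivity
    have hρ := hχ.le_quarter
    have h1 : 2 * ρ * (∫ y, v y * w y * L₂ y ^ 2 * χ y ^ 4) ≤
        1 / 2 * ∫ y, v y * w y * L₂ y ^ 2 * χ y ^ 4 := by gcongr; linarith
    have h2 : (1 / 2 + 2 * ρ * B ^ 2 * W) * (∫ y, v y * L y ^ 2) ≤
        (1 / 2 + 2 * B ^ 2 * W) * ∫ y, v y * L y ^ 2 := by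
      have : 2 * ρ * B ^ 2 * W ≤ 2 * 1 * B ^ 2 * W := by gcongr; linarith
      gcongr
      linarith
    linarith
  · set X := p * L y * L₂ y + w y * L₃ y with hX
    have hv := h.v_pos y
    have e1 := h.abs_hessian_cutoff_error_le hχ hW y
    have e2 : |-(v y * L y * X * χ y ^ 4)| ≤
        1 / 2 * (v y * X ^ 2 * χ y ^ 4) + 1 / 2 * (v y * L y ^ 2) := by
      have : v y * L y * X * χ y ^ 4 = (1 / 2) * (v y * χ y ^ 4) * (2 * (X * L y)) := by ring
      rw [abs_neg, this, abs_mul, abs_of_nonneg (by positivity), abs_mul, abs_two]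
      calc _ ≤ (1 / 2) * (v y * χ y ^ 4) * (X ^ 2 + L y ^ 2) := by
            gcongr
            exact two_mul_abs_le _ _
        _ = 1 / 2 * (v y * X ^ 2 * χ y ^ 4) + 1 / 2 * (v y * L y ^ 2 * χ y ^ 4) := by ring
        _ ≤ 1 / 2 * (v y * X ^ 2 * χ y ^ 4) + 1 / 2 * (v y * L y ^ 2 * 1) := by
            gcongr
            exact hχ.pow_four_le_one y
        _ = _ := by ring
    refine (abs_sub _ _).trans ((add_le_add e2 e1).trans_eq ?_)
    ring

lemma integral_hessian_sub_le (h : PressureProfile p v w L L₂ L₃)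
    {ρ' : ℝ} {η f₁ f₂ : ℝ → ℝ} (hχ : ScaledCutoff B ρ χ e₁ e₂)
    (hη : ScaledCutoff B ρ' η f₁ f₂) (hρ : ρ' ≤ ρ) (hle : ∀ y, χ y ^ 4 ≤ η y ^ 4)
    (hz : ∀ y, η y = 0 → χ y = 0)
    (hW : ∀ y, w y ≤ W) (iL : Integrable fun y => v y * L y ^ 2) {θ : ℝ} (hθ : 0 < θ) :
    (∫ y, v y * w y * L₂ y ^ 2 * η y ^ 4) - (∫ y, v y * w y * L₂ y ^ 2 * χ y ^ 4) ≤
      θ * (∫ y, v y * (p * L y * L₂ y + w y * L₃ y) ^ 2 * η y ^ 4) +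
        θ⁻¹ * ((∫ y, v y * L y ^ 2) - ∫ y, v y * L y ^ 2 * χ y ^ 4) +
        2 * ρ * ((∫ y, v y * w y * L₂ y ^ 2 * η y ^ 4) +
          (∫ y, v y * w y * L₂ y ^ 2 * χ y ^ 4) + 2 * B ^ 2 * W * ∫ y, v y * L y ^ 2) := by
  have cv := h.continuous_v
  have cw := h.continuous_w
  have cL := h.continuous_L
  have cL₂ := h.continuous_L₂
  have cL₃ := h.continuous_L₃
  have cχ := hχ.continuous
  have ce₁ := hχ.continuous_e₁
  have cη := hη.continuous
  have cf₁ := hη.continuous_e₁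
  have iK : Integrable fun y => v y * w y * L₂ y ^ 2 * χ y ^ 4 :=
    hχ.integrable (by fun_prop) (fun y hy => by simp [hy])
  have iK' : Integrable fun y => v y * w y * L₂ y ^ 2 * η y ^ 4 :=
    hη.integrable (by fun_prop) (fun y hy => by simp [hy])
  have iD : Integrable fun y => v y * (p * L y * L₂ y + w y * L₃ y) ^ 2 * η y ^ 4 :=
    hη.integrable (by fun_prop) (fun y hy => by simp [hy])
  have iJ : Integrable fun y => v y * L y ^ 2 * χ y ^ 4 :=
    hχ.integrable (by fun_prop) (fun y hy => by simp [hy])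
  have hW0 : 0 ≤ W := (h.w_pos 0).le.trans (hW 0)
  have hid := h.integral_hessian hη (ψ := fun y => η y ^ 4 - χ y ^ 4)
    (ψ₁ := fun y => 4 * η y ^ 3 * (ρ' * f₁ y) - 4 * χ y ^ 3 * (ρ * e₁ y))
    (fun y => (hη.hasDerivAt_pow_four y).sub (hχ.hasDerivAt_pow_four y)) (by fun_prop)
    (fun y hy => by simp [hy, hz y hy])
  simp only [mul_sub] at hid
  rw [integral_sub iK' iK] at hid
  rw [hid]
  set C := (4 : ℝ) * B ^ 2 * W with hC
  have hbound : ∀ y, |(-(v y * L y * (p * L y * L₂ y + w y * L₃ y) * η y ^ 4 -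
          v y * L y * (p * L y * L₂ y + w y * L₃ y) * χ y ^ 4) -
        (v y * w y * L y * L₂ y * (4 * η y ^ 3 * (ρ' * f₁ y)) -
          v y * w y * L y * L₂ y * (4 * χ y ^ 3 * (ρ * e₁ y))))| ≤
      θ * (v y * (p * L y * L₂ y + w y * L₃ y) ^ 2 * η y ^ 4) +
      2 * ρ * (v y * w y * L₂ y ^ 2 * η y ^ 4 + v y * w y * L₂ y ^ 2 * χ y ^ 4) +
      1 * (θ⁻¹ * (v y * L y ^ 2 - v y * L y ^ 2 * χ y ^ 4) + ρ * C * (v y * L y ^ 2)) := by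
    intro y
    set X := p * L y * L₂ y + w y * L₃ y with hX
    have hv := h.v_pos y
    have hw := h.w_pos y
    have hρ0 := hχ.pos
    have hρ0' := hη.pos
    have e1 := h.abs_hessian_cutoff_error_le hχ hW y
    have e2 := h.abs_hessian_cutoff_error_le hη hW y
    have e2' : 2 * ρ' * (v y * w y * L₂ y ^ 2 * η y ^ 4) + 2 * ρ' * B ^ 2 * W * (v y * L y ^ 2) ≤
        2 * ρ * (v y * w y * L₂ y ^ 2 * η y ^ 4) + 2 * ρ * B ^ 2 * W * (v y * L y ^ 2) := by
      gcongr
    have e3 : |-(v y * L y * X * η y ^ 4 - v y * L y * X * χ y ^ 4)| ≤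
        θ * (v y * X ^ 2 * η y ^ 4) + θ⁻¹ * (v y * L y ^ 2 - v y * L y ^ 2 * χ y ^ 4) := by
      have hψ : 0 ≤ η y ^ 4 - χ y ^ 4 := sub_nonneg.2 (hle y)
      have : v y * L y * X * η y ^ 4 - v y * L y * X * χ y ^ 4 =
          (v y * (η y ^ 4 - χ y ^ 4)) * (X * L y) := by ring
      rw [abs_neg, this, abs_mul, abs_of_nonneg (by positivity)]
      have hXL : |X * L y| ≤ θ * X ^ 2 + θ⁻¹ * L y ^ 2 := by
        have h1 := two_mul_abs_le (θ * X) (L y)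
        rw [mul_assoc, abs_mul, abs_of_pos hθ] at h1
        have h2 : |X * L y| = θ⁻¹ * (θ * |X * L y|) := by field_simp
        have h3 : θ * X ^ 2 + θ⁻¹ * L y ^ 2 = θ⁻¹ * ((θ * X) ^ 2 + L y ^ 2) := by
          field_simp
        rw [h2, h3]
        have h4 : 0 ≤ θ * |X * L y| := by positivity
        gcongr
        linarith
      calc _ ≤ (v y * (η y ^ 4 - χ y ^ 4)) * (θ * X ^ 2 + θ⁻¹ * L y ^ 2) := by gcongr
        _ = θ * (v y * X ^ 2 * (η y ^ 4 - χ y ^ 4)) +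
            θ⁻¹ * (v y * L y ^ 2 * (η y ^ 4 - χ y ^ 4)) := by ring
        _ ≤ θ * (v y * X ^ 2 * η y ^ 4) + θ⁻¹ * (v y * L y ^ 2 * (1 - χ y ^ 4)) := by
          have := hη.pow_four_le_one y
          have h0 : 0 ≤ χ y ^ 4 := pow_nonneg (hχ.nonneg y) 4
          gcongr
          linarith
        _ = _ := by ring
    refine (abs_sub _ _).trans ((add_le_add e3 ((abs_sub _ _).trans
      (add_le_add (e2.trans e2') e1))).trans_eq ?_)
    rw [hC]
    ring
  refine (le_abs_self _).trans ((abs_integral_le_lin_three iD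
    (iK'.add iK) (((iL.sub iJ).const_mul θ⁻¹).add (iL.const_mul (ρ * C))) θ (2 * ρ) 1
    (fun y => by simpa only [Pi.add_apply, Pi.sub_apply] using hbound y)).trans_eq ?_)
  rw [integral_add' iK' iK, integral_add' ((iL.sub iJ).const_mul θ⁻¹) (iL.const_mul (ρ * C)),
    integral_const_mul, integral_const_mul, integral_sub' iL iJ, hC]
  ring

end PressureProfile

lemma neg_cross_le {p B W ρ χ l l₂ w e t X : ℝ} (hp : 1 < p) (he : e ^ 2 ≤ B ^ 2)
    (ht : t ^ 2 ≤ 256 * B ^ 4) (hw : w ^ 2 ≤ W ^ 2) (hρ : ρ ^ 2 ≤ 1) :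
    -(ρ * (X * χ ^ 2 * (4 * (p - 1 / 2) * l ^ 2 * χ * e + 8 * w * l₂ * χ * e + w * l * ρ * t))) ≤
      1 / 2 * (X ^ 2 * χ ^ 4) + ρ ^ 2 * (24 * p ^ 2 * B ^ 2 * (l ^ 4 * χ ^ 2) +
        96 * B ^ 2 * (w ^ 2 * l₂ ^ 2 * χ ^ 2) + 384 * B ^ 4 * W ^ 2 * l ^ 2) := by
  have ha : (4 * (p - 1 / 2) * l ^ 2 * χ * e) ^ 2 ≤ 16 * p ^ 2 * B ^ 2 * (l ^ 4 * χ ^ 2) := by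
    have h1 : (p - 1 / 2) ^ 2 ≤ p ^ 2 := by nlinarith
    calc _ = 16 * ((p - 1 / 2) ^ 2 * e ^ 2) * (l ^ 4 * χ ^ 2) := by ring
      _ ≤ 16 * (p ^ 2 * B ^ 2) * (l ^ 4 * χ ^ 2) := by gcongr
      _ = _ := by ring
  have hb : (8 * w * l₂ * χ * e) ^ 2 ≤ 64 * B ^ 2 * (w ^ 2 * l₂ ^ 2 * χ ^ 2) := by
    calc _ = 64 * e ^ 2 * (w ^ 2 * l₂ ^ 2 * χ ^ 2) := by ring
      _ ≤ _ := by gcongr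
  have hd : (w * l * ρ * t) ^ 2 ≤ 256 * B ^ 4 * W ^ 2 * l ^ 2 := by
    calc _ = ρ ^ 2 * (t ^ 2 * w ^ 2) * l ^ 2 := by ring
      _ ≤ 1 * ((256 * B ^ 4) * W ^ 2) * l ^ 2 := by gcongr
      _ = _ := by ring
  generalize 4 * (p - 1 / 2) * l ^ 2 * χ * e = a at *
  generalize 8 * w * l₂ * χ * e = b at *
  generalize w * l * ρ * t = d at *
  have hY : (a + b + d) ^ 2 ≤ 3 * (a ^ 2 + b ^ 2 + d ^ 2) := by
    nlinarith [sq_nonneg (a - b), sq_nonneg (a - d), sq_nonneg (b - d)]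
  have h1 : -(ρ * (X * χ ^ 2 * (a + b + d))) ≤
      1 / 2 * (X ^ 2 * χ ^ 4) + 1 / 2 * (ρ ^ 2 * (a + b + d) ^ 2) := by
    linarith [sq_nonneg (X * χ ^ 2 + ρ * (a + b + d))]
  have h2 : ρ ^ 2 * (a + b + d) ^ 2 ≤ ρ ^ 2 * (2 * (24 * p ^ 2 * B ^ 2 * (l ^ 4 * χ ^ 2) +
      96 * B ^ 2 * (w ^ 2 * l₂ ^ 2 * χ ^ 2) + 384 * B ^ 4 * W ^ 2 * l ^ 2)) :=
    mul_le_mul_of_nonneg_left (by linarith) (sq_nonneg ρ)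
  linarith

namespace PressureProfile

variable {p B ρ W : ℝ} {v w L L₂ L₃ χ e₁ e₂ : ℝ → ℝ}

lemma integral_fisher_flux (h : PressureProfile p v w L L₂ L₃)
    (hχ : ScaledCutoff B ρ χ e₁ e₂) {G₂ q ℓ₁ : ℝ → ℝ} {c κ : ℝ} (hG₂ : Continuous G₂)
    (hG : ∀ y, HasDerivAt (fun z => v z * (p * L z * L₂ z + w z * L₃ z)) (G₂ y) y)
    (hq : ∀ y, q y = -(c * G₂ y) + κ * (v y + y * (v y * L y / w y)))
    (hℓ : ∀ y, HasDerivAt (fun z => w z * q z / v z) (ℓ₁ y) y) (cℓ₁ : Continuous ℓ₁) :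
    ∫ y, (1 / 2 * q y * L y ^ 2 + v y * L y * ℓ₁ y) * χ y ^ 4 =
      ∫ y, (-(c * (v y * (p * L y * L₂ y + w y * L₃ y) ^ 2 * χ y ^ 4 +
        ρ * (v y * ((p * L y * L₂ y + w y * L₃ y) * χ y ^ 2) *
          (4 * (p - 1 / 2) * L y ^ 2 * χ y * e₁ y + 8 * w y * L₂ y * χ y * e₁ y +
            w y * L y * ρ * (12 * e₁ y ^ 2 + 4 * χ y * e₂ y))))) +
        κ * (v y * L y ^ 2 * (p * χ y ^ 4 - 2 * (ρ * y * χ y ^ 3 * e₁ y)))) := by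
  have cv := h.continuous_v
  have cw := h.continuous_w
  have cL := h.continuous_L
  have cL₂ := h.continuous_L₂
  have cL₃ := h.continuous_L₃
  have cχ := hχ.continuous
  have ce₁ := hχ.continuous_e₁
  have ce₂ := hχ.continuous_e₂
  have hw0 : ∀ y, w y ≠ 0 := fun y => (h.w_pos y).ne'
  have cq : Continuous q := by
    rw [show q = fun y => -(c * G₂ y) + κ * (v y + y * (v y * L y / w y)) from funext hq]
    fun_prop (disch := assumption)
  have key := hχ.integral_deriv_eq_zero
    (f := fun y => v y * L y * (w y * q y / v y) * χ y ^ 4 +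
      c * (v y * (p * L y * L₂ y + w y * L₃ y) *
        ((1 / 2 * L y ^ 2 + w y * L₂ y) * χ y ^ 4 + w y * L y * (4 * χ y ^ 3 * (ρ * e₁ y)))) -
      κ * (χ y ^ 4 * (1 / 2 * y * v y * L y ^ 2 + w y * v y * L y)))
    (f' := fun y => (1 / 2 * q y * L y ^ 2 + v y * L y * ℓ₁ y) * χ y ^ 4 -
      (-(c * (v y * (p * L y * L₂ y + w y * L₃ y) ^ 2 * χ y ^ 4 +
        ρ * (v y * ((p * L y * L₂ y + w y * L₃ y) * χ y ^ 2) *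
          (4 * (p - 1 / 2) * L y ^ 2 * χ y * e₁ y + 8 * w y * L₂ y * χ y * e₁ y +
            w y * L y * ρ * (12 * e₁ y ^ 2 + 4 * χ y * e₂ y))))) +
        κ * (v y * L y ^ 2 * (p * χ y ^ 4 - 2 * (ρ * y * χ y ^ 3 * e₁ y)))))
    (fun y => by
      have hw := (h.w_pos y).ne'
      have hv := (h.v_pos y).ne'
      refine (((((h.hasDerivAt_v y).mul (h.hasDerivAt_L y)).mul (hℓ y)).mul
        (hχ.hasDerivAt_pow_four y)).add (((hG y).mul
        ((((((h.hasDerivAt_L y).pow 2).const_mul (1 / 2)).add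
          ((h.hasDerivAt_w y).mul (h.hasDerivAt_L₂ y))).mul (hχ.hasDerivAt_pow_four y)).add
          (((h.hasDerivAt_w y).mul (h.hasDerivAt_L y)).mul
            (((hχ.hasDerivAt_pow_three y).const_mul 4).mul
              ((hχ.hasDerivAt_e₁ y).const_mul ρ))))).const_mul c)).sub
        (((hχ.hasDerivAt_pow_four y).mul
          (((((hasDerivAt_id y).const_mul (1 / 2)).mul (h.hasDerivAt_v y)).mul
            ((h.hasDerivAt_L y).pow 2)).add
            (((h.hasDerivAt_w y).mul (h.hasDerivAt_v y)).mul (h.hasDerivAt_L y)))).const_mul κ)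
        |>.congr_deriv ?_
      simp only [Pi.mul_apply, Pi.add_apply, Pi.pow_apply, id, hq]
      field_simp
      ring)
    (by fun_prop) (fun y hy => by simp [hy])
  rw [integral_sub] at key
  · linarith
  · exact hχ.integrable (by fun_prop) (fun y hy => by simp [hy])
  · exact hχ.integrable (by fun_prop) (fun y hy => by simp [hy])

lemma integral_quartic_le (h : PressureProfile p v w L L₂ L₃)
    (hχ : ScaledCutoff B ρ χ e₁ e₂) (hW : ∀ y, w y ≤ W) (iL : Integrable fun y => v y * L y ^ 2) :
    ∫ y, v y * L y ^ 4 * χ y ^ 2 ≤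
      36 * (∫ y, v y * w y ^ 2 * L₂ y ^ 2 * χ y ^ 2) +
        B ^ 2 * W ^ 2 * ∫ y, v y * L y ^ 2 := by
  have cv := h.continuous_v
  have cw := h.continuous_w
  have cL := h.continuous_L
  have cL₂ := h.continuous_L₂
  have cχ := hχ.continuous
  have ce₁ := hχ.continuous_e₁
  have iQ : Integrable fun y => v y * L y ^ 4 * χ y ^ 2 :=
    hχ.integrable (by fun_prop) (fun y hy => by simp [hy])
  have iP : Integrable fun y => v y * w y ^ 2 * L₂ y ^ 2 * χ y ^ 2 :=
    hχ.integrable (by fun_prop) (fun y hy => by simp [hy])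
  have key := hχ.integral_deriv_eq_zero
    (f := fun y => v y * w y * L y ^ 3 * χ y ^ 2)
    (f' := fun y => p * (v y * L y ^ 4 * χ y ^ 2) -
      v y * w y * (-(3 * L y ^ 2 * L₂ y * χ y ^ 2 + 2 * L y ^ 3 * χ y * (ρ * e₁ y))))
    (fun y => by
      have hw := (h.w_pos y).ne'
      refine ((((h.hasDerivAt_v y).mul (h.hasDerivAt_w y)).mul ((h.hasDerivAt_L y).pow 3)).mul
        (hχ.hasDerivAt_pow_two y)).congr_deriv ?_
      simp only [Pi.mul_apply, Pi.pow_apply]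
      field_simp
      ring)
    (by fun_prop) (fun y hy => by simp [hy])
  rw [integral_sub (iQ.const_mul p)
    (hχ.integrable (by fun_prop) (fun y hy => by simp [hy])), integral_const_mul] at key
  have hb := abs_integral_le_lin_three iQ iP iL (1 / 2) 18 (1 / 2 * B ^ 2 * W ^ 2)
    (F := fun y => v y * w y *
      (-(3 * L y ^ 2 * L₂ y * χ y ^ 2 + 2 * L y ^ 3 * χ y * (ρ * e₁ y)))) fun y => by
    have hv := h.v_pos y
    have hw := h.w_pos y
    have hρ := hχ.pos
    have hρ4 := hχ.le_quarter
    have h1 := two_mul_abs_le (1 / 2 * (L y ^ 2 * χ y)) (6 * (w y * L₂ y * χ y))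
    have h2 := two_mul_abs_le (1 / 2 * (L y ^ 2 * χ y)) (2 * (w y * L y * (ρ * e₁ y)))
    have h3 : (2 * (w y * L y * (ρ * e₁ y))) ^ 2 ≤ 1 / 4 * B ^ 2 * W ^ 2 * L y ^ 2 := by
      have he := hχ.sq_e₁_le y
      have ha : w y ^ 2 ≤ W ^ 2 := pow_le_pow_left₀ hw.le (hW y) 2
      have hbb : ρ ^ 2 ≤ (1 / 4) ^ 2 := pow_le_pow_left₀ hρ.le hρ4 2
      calc _ = 4 * w y ^ 2 * L y ^ 2 * (ρ ^ 2 * e₁ y ^ 2) := by ring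
        _ ≤ 4 * W ^ 2 * L y ^ 2 * ((1 / 4) ^ 2 * B ^ 2) :=
          mul_le_mul (by gcongr) (mul_le_mul hbb he (sq_nonneg _) (by positivity))
            (by positivity) (by positivity)
        _ = _ := by ring
    have e1 : v y * w y *
        (-(3 * L y ^ 2 * L₂ y * χ y ^ 2 + 2 * L y ^ 3 * χ y * (ρ * e₁ y))) =
        -(v y * ((1 / 2 * (L y ^ 2 * χ y)) * (6 * (w y * L₂ y * χ y)) +
          2 * ((1 / 2 * (L y ^ 2 * χ y)) * (2 * (w y * L y * (ρ * e₁ y)))))) := by ring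
    rw [e1, abs_neg, abs_mul, abs_of_pos hv]
    have hQ : 0 ≤ v y * L y ^ 4 * χ y ^ 2 := by positivity
    have hJ : 0 ≤ v y * (B ^ 2 * W ^ 2 * L y ^ 2) := by positivity
    calc _ ≤ v y * (1 / 2 * ((1 / 2 * (L y ^ 2 * χ y)) ^ 2 + (6 * (w y * L₂ y * χ y)) ^ 2) +
          ((1 / 2 * (L y ^ 2 * χ y)) ^ 2 + 1 / 4 * B ^ 2 * W ^ 2 * L y ^ 2)) := by
          gcongr
          refine (abs_add_le _ _).trans ?_
          rw [abs_mul 2, abs_two]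
          linarith
      _ = 3 / 8 * (v y * L y ^ 4 * χ y ^ 2) + 18 * (v y * w y ^ 2 * L₂ y ^ 2 * χ y ^ 2) +
          1 / 4 * (v y * (B ^ 2 * W ^ 2 * L y ^ 2)) := by ring
      _ ≤ _ := by linarith
  have hQ0 : 0 ≤ ∫ y, v y * L y ^ 4 * χ y ^ 2 := integral_nonneg fun y => by
    have := h.v_pos y
    dsimp only
    positivity
  have hp := h.one_lt
  have := (le_abs_self _).trans hb
  nlinarith

lemma fisher_flux_pointwise_le (h : PressureProfile p v w L L₂ L₃)
    (hχ : ScaledCutoff B ρ χ e₁ e₂) (hW : ∀ y, w y ≤ W) {c κ : ℝ} (hc : 0 ≤ c) (hκ : 0 ≤ κ)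
    (y : ℝ) :
    -(c * (v y * (p * L y * L₂ y + w y * L₃ y) ^ 2 * χ y ^ 4 +
        ρ * (v y * ((p * L y * L₂ y + w y * L₃ y) * χ y ^ 2) *
          (4 * (p - 1 / 2) * L y ^ 2 * χ y * e₁ y + 8 * w y * L₂ y * χ y * e₁ y +
            w y * L y * ρ * (12 * e₁ y ^ 2 + 4 * χ y * e₂ y))))) +
        κ * (v y * L y ^ 2 * (p * χ y ^ 4 - 2 * (ρ * y * χ y ^ 3 * e₁ y))) ≤
      -(c / 2) * (v y * (p * L y * L₂ y + w y * L₃ y) ^ 2 * χ y ^ 4) +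
      c * ρ ^ 2 * (24 * p ^ 2 * B ^ 2) * (v y * L y ^ 4 * χ y ^ 2) +
      c * ρ ^ 2 * (96 * B ^ 2) * (v y * w y ^ 2 * L₂ y ^ 2 * χ y ^ 2) +
      (c * ρ ^ 2 * (384 * B ^ 4 * W ^ 2) + κ * (p + 4 * B)) * (v y * L y ^ 2) := by
  have hp := h.one_lt
  have hv := h.v_pos y
  have hmom : p * χ y ^ 4 - 2 * (ρ * y * χ y ^ 3 * e₁ y) ≤ p + 4 * B := by
    have h1 := abs_le.1 (hχ.abs_first_moment_le y)
    have h2 := mul_le_mul_of_nonneg_left (hχ.pow_four_le_one y) (zero_le_one.trans hp.le)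
    linarith [h1.1]
  have hcross := neg_cross_le (X := p * L y * L₂ y + w y * L₃ y) (χ := χ y) (l := L y)
    (l₂ := L₂ y) hp (hχ.sq_e₁_le y) (hχ.second_sq_le y)
    (pow_le_pow_left₀ (h.w_pos y).le (hW y) 2)
    (pow_le_one₀ hχ.pos.le (by linarith [hχ.le_quarter]) : ρ ^ 2 ≤ 1)
  have s1 := mul_le_mul_of_nonneg_left hcross (mul_nonneg hc hv.le)
  have s2 := mul_le_mul_of_nonneg_left hmom (show 0 ≤ κ * (v y * L y ^ 2) by positivity)
  generalize p * L y * L₂ y + w y * L₃ y = X at *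
  generalize 12 * e₁ y ^ 2 + 4 * χ y * e₂ y = t at *
  linarith

lemma integral_fisher_flux_le (h : PressureProfile p v w L L₂ L₃)
    {ρ' : ℝ} {η f₁ f₂ : ℝ → ℝ} (hχ : ScaledCutoff B ρ χ e₁ e₂)
    (hη : ScaledCutoff B ρ' η f₁ f₂) (hle : ∀ y, χ y ^ 2 ≤ η y ^ 4)
    (hW : ∀ y, w y ≤ W) (iL : Integrable fun y => v y * L y ^ 2)
    {G₂ q ℓ₁ : ℝ → ℝ} {c κ : ℝ} (hc : 0 ≤ c) (hκ : 0 ≤ κ) (hG₂ : Continuous G₂)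
    (hG : ∀ y, HasDerivAt (fun z => v z * (p * L z * L₂ z + w z * L₃ z)) (G₂ y) y)
    (hq : ∀ y, q y = -(c * G₂ y) + κ * (v y + y * (v y * L y / w y)))
    (hℓ : ∀ y, HasDerivAt (fun z => w z * q z / v z) (ℓ₁ y) y) (cℓ₁ : Continuous ℓ₁) :
    ∫ y, (1 / 2 * q y * L y ^ 2 + v y * L y * ℓ₁ y) * χ y ^ 4 ≤
      -(c / 2) * (∫ y, v y * (p * L y * L₂ y + w y * L₃ y) ^ 2 * χ y ^ 4) +
      c * ρ ^ 2 * (960 * p ^ 2 * B ^ 2 * W * (∫ y, v y * w y * L₂ y ^ 2 * η y ^ 4) +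
        408 * p ^ 2 * B ^ 4 * W ^ 2 * ∫ y, v y * L y ^ 2) +
      κ * (p + 4 * B) * ∫ y, v y * L y ^ 2 := by
  have cv := h.continuous_v
  have cw := h.continuous_w
  have cL := h.continuous_L
  have cL₂ := h.continuous_L₂
  have cL₃ := h.continuous_L₃
  have cχ := hχ.continuous
  have ce₁ := hχ.continuous_e₁
  have ce₂ := hχ.continuous_e₂
  have cη := hη.continuous
  have hp := h.one_lt
  have hB := hχ.one_le
  have hW0 : 0 ≤ W := (h.w_pos 0).le.trans (hW 0)
  have iD : Integrable fun y => v y * (p * L y * L₂ y + w y * L₃ y) ^ 2 * χ y ^ 4 :=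
    hχ.integrable (by fun_prop) (fun y hy => by simp [hy])
  have iQ : Integrable fun y => v y * L y ^ 4 * χ y ^ 2 :=
    hχ.integrable (by fun_prop) (fun y hy => by simp [hy])
  have iP : Integrable fun y => v y * w y ^ 2 * L₂ y ^ 2 * χ y ^ 2 :=
    hχ.integrable (by fun_prop) (fun y hy => by simp [hy])
  have iK : Integrable fun y => v y * w y * L₂ y ^ 2 * η y ^ 4 :=
    hη.integrable (by fun_prop) (fun y hy => by simp [hy])
  have hQ := h.integral_quartic_le hχ hW iL
  have hP : ∫ y, v y * w y ^ 2 * L₂ y ^ 2 * χ y ^ 2 ≤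
      W * ∫ y, v y * w y * L₂ y ^ 2 * η y ^ 4 := by
    rw [← integral_const_mul]
    refine integral_mono iP (iK.const_mul W) fun y => ?_
    have hv := h.v_pos y
    have hw := h.w_pos y
    calc v y * w y ^ 2 * L₂ y ^ 2 * χ y ^ 2 = w y * (v y * w y * L₂ y ^ 2 * χ y ^ 2) := by ring
      _ ≤ W * (v y * w y * L₂ y ^ 2 * η y ^ 4) := by
        gcongr
        exacts [hW y, hle y]
  have i4 := integral_lin_three iD iQ iP (-(c / 2)) (c * ρ ^ 2 * (24 * p ^ 2 * B ^ 2))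
    (c * ρ ^ 2 * (96 * B ^ 2))
  have i5 : Integrable fun y => (-(c / 2)) * (v y * (p * L y * L₂ y + w y * L₃ y) ^ 2 * χ y ^ 4) +
      c * ρ ^ 2 * (24 * p ^ 2 * B ^ 2) * (v y * L y ^ 4 * χ y ^ 2) +
      c * ρ ^ 2 * (96 * B ^ 2) * (v y * w y ^ 2 * L₂ y ^ 2 * χ y ^ 2) :=
    ((iD.const_mul _).add (iQ.const_mul _)).add (iP.const_mul _)
  have i6 := iL.const_mul (c * ρ ^ 2 * (384 * B ^ 4 * W ^ 2) + κ * (p + 4 * B))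
  have hJ0 : 0 ≤ ∫ y, v y * L y ^ 2 := integral_nonneg fun y => by
    have := h.v_pos y
    dsimp only
    positivity
  rw [h.integral_fisher_flux hχ hG₂ hG hq hℓ cℓ₁]
  refine (integral_mono (hχ.integrable (by fun_prop) (fun y hy => by simp [hy]))
    (i5.add i6) fun y => ?_).trans ?_
  · have := h.fisher_flux_pointwise_le hχ hW hc hκ y
    simp only [Pi.add_apply]
    linarith
  · rw [integral_add' i5 i6, i4, integral_const_mul]
    have s0 : 0 ≤ c * ρ ^ 2 := by positivity
    have s1 : 24 * p ^ 2 * B ^ 2 * (∫ y, v y * L y ^ 4 * χ y ^ 2) +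
        96 * B ^ 2 * (∫ y, v y * w y ^ 2 * L₂ y ^ 2 * χ y ^ 2) +
        384 * B ^ 4 * W ^ 2 * (∫ y, v y * L y ^ 2) ≤
        960 * p ^ 2 * B ^ 2 * W * (∫ y, v y * w y * L₂ y ^ 2 * η y ^ 4) +
        408 * p ^ 2 * B ^ 4 * W ^ 2 * ∫ y, v y * L y ^ 2 := by
      have hp2 : 1 ≤ p ^ 2 := one_le_pow₀ hp.le
      have t0 : 0 ≤ ∫ y, v y * w y ^ 2 * L₂ y ^ 2 * χ y ^ 2 := integral_nonneg fun y => by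
        have := h.v_pos y
        dsimp only
        positivity
      have t1 := mul_le_mul_of_nonneg_left hQ (show 0 ≤ 24 * p ^ 2 * B ^ 2 by positivity)
      have t2 := mul_le_mul_of_nonneg_left hP (show 0 ≤ 960 * p ^ 2 * B ^ 2 by positivity)
      have t3 := mul_nonneg (mul_nonneg (sub_nonneg.2 hp2) (sq_nonneg B)) t0
      have t4 := mul_nonneg (mul_nonneg (sub_nonneg.2 hp2)
        (show 0 ≤ B ^ 4 * W ^ 2 by positivity)) hJ0
      linarith
    have s2 := mul_le_mul_of_nonneg_left s1 s0
    linarith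

end PressureProfile

/-- A nested sequence of smooth cutoffs at scales `2 ^ (k + 2)`. -/
structure CutoffSequence (B : ℝ) (χ e₁ e₂ : ℕ → ℝ → ℝ) : Prop where
  scaled : ∀ k, ScaledCutoff B ((1 / 2) ^ (k + 2)) (χ k) (e₁ k) (e₂ k)
  contDiff : ∀ k, ContDiff ℝ (⊤ : ℕ∞) (χ k)
  succ_eq_one : ∀ k y, χ k y ≠ 0 → χ (k + 1) y = 1
  eq_zero_of_succ : ∀ k y, e₁ (k + 1) y ≠ 0 → χ k y = 0
  eventually_eq_one : ∀ y, ∀ᶠ k in atTop, χ k y = 1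

lemma exists_cutoffSequence : ∃ (B : ℝ) (χ e₁ e₂ : ℕ → ℝ → ℝ), CutoffSequence B χ e₁ e₂ := by
  let f : ContDiffBump (0 : ℝ) := ⟨1, 2, one_pos, one_lt_two⟩
  have hf : ContDiff ℝ (⊤ : ℕ∞) f := f.contDiff
  have hf1 : ContDiff ℝ (⊤ : ℕ∞) (deriv f) := (contDiff_infty_iff_deriv.1 hf).2
  have hf2 : ContDiff ℝ (⊤ : ℕ∞) (deriv (deriv f)) := (contDiff_infty_iff_deriv.1 hf1).2
  have d1 : ∀ y, HasDerivAt f (deriv f y) y := fun y =>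
    ((contDiff_infty_iff_deriv.1 hf).1 y).hasDerivAt
  have d2 : ∀ y, HasDerivAt (deriv f) (deriv (deriv f) y) y := fun y =>
    ((contDiff_infty_iff_deriv.1 hf1).1 y).hasDerivAt
  obtain ⟨C₁, hC₁⟩ := f.hasCompactSupport.deriv.exists_bound_of_continuous hf1.continuous
  obtain ⟨C₂, hC₂⟩ := f.hasCompactSupport.deriv.deriv.exists_bound_of_continuous hf2.continuous
  have hone : ∀ y, |y| ≤ 1 → f y = 1 := fun y hy =>
    f.one_of_mem_closedBall (by simpa [f, Real.dist_eq] using hy)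
  have hzero : ∀ y, 2 ≤ |y| → f y = 0 := fun y hy =>
    f.zero_of_le_dist (by simpa [f, Real.dist_eq] using hy)
  have hderiv : ∀ y, |y| < 1 → deriv f y = 0 := fun y hy => by
    have : (f : ℝ → ℝ) =ᶠ[nhds y] fun _ => 1 := by
      filter_upwards [(continuous_abs.isOpen_preimage _ isOpen_Iio).mem_nhds hy] with z hz
      exact hone z (le_of_lt hz)
    rw [this.deriv_eq, deriv_const]
  have hpos : ∀ k : ℕ, (0 : ℝ) < (1 / 2) ^ (k + 2) := fun k => by positivity
  refine ⟨max 1 (max C₁ C₂), fun k y => f ((1 / 2) ^ (k + 2) * y),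
    fun k y => deriv f ((1 / 2) ^ (k + 2) * y),
    fun k y => deriv (deriv f) ((1 / 2) ^ (k + 2) * y), ?_⟩
  have hlin : ∀ (ρ y : ℝ), HasDerivAt (fun z => ρ * z) ρ y := fun ρ y => by
    simpa using (hasDerivAt_id y).const_mul ρ
  refine ⟨fun k => ⟨le_max_left _ _, hpos k, ?_, fun y => ?_, fun y => ?_, ?_, fun y => f.nonneg,
    fun y => f.le_one, fun y => ?_, fun y => ?_, fun y hy => hzero _ hy.le, fun y hy =>
    hderiv _ hy⟩, fun k => ?_, fun k y hy => ?_, fun k y hy => ?_, fun y => ?_⟩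
  · rw [pow_add]
    have : ((1 : ℝ) / 2) ^ k ≤ 1 := pow_le_one₀ (by norm_num) (by norm_num)
    linarith
  · rw [mul_comm]
    exact (d1 _).comp y (hlin _ y)
  · rw [mul_comm]
    exact (d2 _).comp y (hlin _ y)
  · exact hf2.continuous.comp (continuous_const.mul continuous_id)
  · exact (hC₁ _).trans ((le_max_left _ _).trans (le_max_right _ _))
  · exact (hC₂ _).trans ((le_max_right _ _).trans (le_max_right _ _))
  · exact hf.comp (contDiff_const.mul contDiff_id)
  · refine hone _ ?_
    by_contra! h
    refine hy (hzero _ ?_)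
    have : (1 / 2 : ℝ) ^ (k + 2) * y = 2 * ((1 / 2) ^ (k + 1 + 2) * y) := by ring
    rw [this, abs_mul, abs_two]
    linarith
  · refine hzero _ ?_
    by_contra! h
    refine hy (hderiv _ ?_)
    have : (1 / 2 : ℝ) ^ (k + 2) * y = 2 * ((1 / 2) ^ (k + 1 + 2) * y) := by ring
    rw [this, abs_mul, abs_two] at h
    linarith
  · have ht : Tendsto (fun k : ℕ => |(1 / 2 : ℝ) ^ (k + 2) * y|) atTop (nhds |0 * y|) :=
      (((tendsto_pow_atTop_nhds_zero_of_lt_one (by norm_num) (by norm_num)).comp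
        (tendsto_add_atTop_nat 2)).mul_const y).abs
    simp only [zero_mul, abs_zero] at ht
    filter_upwards [ht.eventually (Iio_mem_nhds one_pos)] with k hk
    exact hone _ (le_of_lt hk)

lemma tendsto_half_pow_add_two : Tendsto (fun k : ℕ => ((1 : ℝ) / 2) ^ (k + 2)) atTop (nhds 0) :=
  (tendsto_pow_atTop_nhds_zero_of_lt_one (by norm_num) (by norm_num)).comp
    (tendsto_add_atTop_nat 2)

namespace CutoffSequence

variable {B : ℝ} {χ e₁ e₂ : ℕ → ℝ → ℝ} (hχ : CutoffSequence B χ e₁ e₂)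
include hχ

lemma pow_le_pow_succ {m n : ℕ} (hm : m ≠ 0) (k : ℕ) (y : ℝ) : χ k y ^ m ≤ χ (k + 1) y ^ n := by
  by_cases h : χ k y = 0
  · rw [h, zero_pow hm]
    exact pow_nonneg ((hχ.scaled _).nonneg y) n
  · rw [hχ.succ_eq_one k y h, one_pow]
    exact pow_le_one₀ ((hχ.scaled k).nonneg y) ((hχ.scaled k).le_one y)

lemma monotone_pow_four (y : ℝ) : Monotone fun k => χ k y ^ 4 :=
  monotone_nat_of_le_succ fun k => hχ.pow_le_pow_succ four_ne_zero k y

lemma eq_zero_of_le {j k : ℕ} (hjk : j ≤ k) (y : ℝ) (hy : χ k y = 0) : χ j y = 0 := by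
  have := hχ.monotone_pow_four y hjk
  simp only [hy, ne_eq, OfNat.ofNat_ne_zero, not_false_eq_true, zero_pow] at this
  exact pow_eq_zero_iff four_ne_zero |>.1 (le_antisymm this (pow_nonneg ((hχ.scaled j).nonneg y) 4))

lemma integral_mono {f : ℝ → ℝ} (hf : Continuous f) (h0 : ∀ y, 0 ≤ f y) {j k : ℕ} (hjk : j ≤ k) :
    ∫ y, f y * χ j y ^ 4 ≤ ∫ y, f y * χ k y ^ 4 := by
  have c := fun k => (hχ.scaled k).continuous
  refine MeasureTheory.integral_mono
    ((hχ.scaled j).integrable (hf.mul ((c j).pow 4)) (fun y hy => by simp [hy]))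
    ((hχ.scaled k).integrable (hf.mul ((c k).pow 4)) (fun y hy => by simp [hy])) fun y => ?_
  exact mul_le_mul_of_nonneg_left (hχ.monotone_pow_four y hjk) (h0 y)

lemma integral_le {f : ℝ → ℝ} (hf : Continuous f) (h0 : ∀ y, 0 ≤ f y) (hi : Integrable f) (k : ℕ) :
    ∫ y, f y * χ k y ^ 4 ≤ ∫ y, f y := by
  have c := (hχ.scaled k).continuous
  refine MeasureTheory.integral_mono
    ((hχ.scaled k).integrable (hf.mul (c.pow 4)) (fun y hy => by simp [hy])) hi fun y => ?_
  exact mul_le_of_le_one_right (h0 y) ((hχ.scaled k).pow_four_le_one y)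

lemma tendsto_integral {f : ℝ → ℝ} (hf : Continuous f) (hi : Integrable f) :
    Tendsto (fun k => ∫ y, f y * χ k y ^ 4) atTop (nhds (∫ y, f y)) := by
  have c := fun k => (hχ.scaled k).continuous
  refine tendsto_integral_of_dominated_convergence (fun y => ‖f y‖)
    (fun k => (hf.mul ((c k).pow 4)).aestronglyMeasurable) hi.norm
    (fun k => Eventually.of_forall fun y => ?_) (Eventually.of_forall fun y => ?_)
  · rw [norm_mul]
    refine mul_le_of_le_one_right (norm_nonneg _) ?_
    rw [Real.norm_of_nonneg (pow_nonneg ((hχ.scaled k).nonneg y) 4)]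
    exact (hχ.scaled k).pow_four_le_one y
  · refine tendsto_const_nhds.congr' ?_
    filter_upwards [hχ.eventually_eq_one y] with k hk
    simp [hk]

lemma integrable_of_bound {f : ℝ → ℝ} (hf : Continuous f) (h0 : ∀ y, 0 ≤ f y) {C : ℝ}
    (hC : ∀ k, ∫ y, f y * χ k y ^ 4 ≤ C) : Integrable f := by
  have c := fun k => (hχ.scaled k).continuous
  have i := fun k => (hχ.scaled k).integrable (f := fun y => f y * χ k y ^ 4)
    (hf.mul ((c k).pow 4)) (fun y hy => by simp [hy])
  refine ⟨hf.aestronglyMeasurable, ?_⟩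
  have hmono := lintegral_iSup (μ := volume) (f := fun k y => ENNReal.ofReal (f y * χ k y ^ 4))
    (fun k => (hf.mul ((c k).pow 4)).measurable.ennreal_ofReal)
    (fun j k hjk y => ENNReal.ofReal_le_ofReal
      (mul_le_mul_of_nonneg_left (hχ.monotone_pow_four y hjk) (h0 y)))
  rw [hasFiniteIntegral_iff_ofReal (Eventually.of_forall h0)]
  have hle : ∫⁻ y, ENNReal.ofReal (f y) ≤
      ∫⁻ y, ⨆ k, ENNReal.ofReal (f y * χ k y ^ 4) := lintegral_mono fun y => by
    obtain ⟨k, hk⟩ := (hχ.eventually_eq_one y).exists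
    refine le_iSup_of_le k ?_
    simp [hk]
  refine (hle.trans_eq hmono).trans_lt ((iSup_le fun k => ?_).trans_lt
    (ENNReal.ofReal_lt_top (r := C)))
  rw [← ofReal_integral_eq_lintegral_ofReal (i k) (Eventually.of_forall fun y =>
    mul_nonneg (h0 y) (pow_nonneg ((hχ.scaled k).nonneg y) 4))]
  exact ENNReal.ofReal_le_ofReal (hC k)

end CutoffSequence

namespace PressureProfile

variable {p B ρ W : ℝ} {v w L L₂ L₃ : ℝ → ℝ}

lemma mul_le_of_tendsto (h : PressureProfile p v w L L₂ L₃) (iv : Integrable v)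
    (iL : Integrable fun y => v y * L y ^ 2) (h0 : Tendsto (fun y => v y * w y) atBot (nhds 0))
    (y : ℝ) : v y * w y ≤ p / 2 * ((∫ y, v y) + ∫ y, v y * L y ^ 2) := by
  have cv := h.continuous_v
  have cL := h.continuous_L
  have hp := h.one_lt
  have hbd : ∀ z, ‖p * (v z * L z)‖ ≤ p / 2 * (v z + v z * L z ^ 2) := fun z => by
    have hv := h.v_pos z
    rw [Real.norm_eq_abs, abs_mul, abs_mul, abs_of_pos hv, abs_of_pos (zero_lt_one.trans hp)]
    have := two_mul_abs_le 1 (L z)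
    rw [one_mul] at this
    calc p * (v z * |L z|) = p * v z * |L z| := by ring
      _ ≤ p * v z * (1 / 2 * (1 ^ 2 + L z ^ 2)) := by gcongr; linarith
      _ = _ := by ring
  have iS : Integrable fun z => p / 2 * (v z + v z * L z ^ 2) := (iv.add iL).const_mul _
  have ig : Integrable fun z => p * (v z * L z) :=
    iS.mono' (by fun_prop) (Eventually.of_forall hbd)
  have hd : ∀ z, HasDerivAt (fun y => v y * w y) (p * (v z * L z)) z := fun z => by
    have hw := (h.w_pos z).ne'
    refine ((h.hasDerivAt_v z).mul (h.hasDerivAt_w z)).congr_deriv ?_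
    field_simp
    ring
  have key := integral_Iic_of_hasDerivAt_of_tendsto' (fun z _ => hd z) ig.integrableOn h0 (a := y)
  rw [sub_zero] at key
  rw [← key, ← integral_add iv iL, ← integral_const_mul]
  calc _ ≤ ∫ z in Iic y, p / 2 * (v z + v z * L z ^ 2) :=
        integral_mono ig.integrableOn iS.integrableOn fun z => (le_abs_self _).trans (hbd z)
    _ ≤ _ := setIntegral_le_integral iS (Eventually.of_forall fun z => (norm_nonneg _).trans (hbd z))

lemma integral_entropy_rate (h : PressureProfile p v w L L₂ L₃) {χ e₁ e₂ : ℕ → ℝ → ℝ}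
    (hχ : CutoffSequence B χ e₁ e₂) (hW : ∀ y, w y ≤ W) (iv : Integrable v)
    (iL : Integrable fun y => v y * L y ^ 2) {G₂ q : ℝ → ℝ} {c κ : ℝ} (hG₂ : Continuous G₂)
    (hG : ∀ y, HasDerivAt (fun z => v z * (p * L z * L₂ z + w z * L₃ z)) (G₂ y) y)
    (hq : ∀ y, q y = -(c * G₂ y) + κ * (v y + y * (v y * L y / w y))) (k : ℕ) :
    ∃ r d : ℝ, ∫ y, p * w y * q y * χ (k + 1) y ^ 4 =
      -(c * p) * ((p - 1) * (∫ y, v y * w y * L₂ y ^ 2 * χ (k + 1) y ^ 4) + r) +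
        κ * ((p - 1) * (∫ y, v y * w y * χ (k + 1) y ^ 4) - d) ∧
      |r| ≤ (1 / 2) ^ (k + 1 + 2) * ((4 * p) * (∫ y, v y * w y * L₂ y ^ 2 * χ (k + 1) y ^ 4) +
        (4 * p * B ^ 2 * W) * (∫ y, v y * L y ^ 2) + (128 * B ^ 4 * W ^ 3) * ∫ y, v y) ∧
      |d| ≤ 8 * B * W * ((∫ y, v y) - ∫ y, v y * χ k y ^ 4) := by
  have cv := h.continuous_v
  have cw := h.continuous_w
  have cL := h.continuous_L
  have hs := hχ.scaled (k + 1)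
  have cχ := hs.continuous
  have cχ' := (hχ.scaled k).continuous
  have ce₁ := hs.continuous_e₁
  have hw0 : ∀ y, w y ≠ 0 := fun y => (h.w_pos y).ne'
  have hB := hs.one_le
  have hW0 : 0 ≤ W := (h.w_pos 0).le.trans (hW 0)
  refine ⟨_, 4 * ∫ y, v y * w y * ((1 / 2) ^ (k + 1 + 2) * y * χ (k + 1) y ^ 3 * e₁ (k + 1) y), ?_,
    h.abs_entropy_flux_error_le hs hW iv iL, ?_⟩
  · rw [← h.integral_entropy_flux hs hG₂ hG, ← h.integral_entropy_drift hs,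
      ← integral_lin_two]
    · refine integral_congr_ae (Eventually.of_forall fun y => ?_)
      simp only [hq]
      ring
    · exact hs.integrable (by fun_prop) (fun y hy => by simp [hy])
    · exact hs.integrable (by fun_prop (disch := assumption)) (fun y hy => by simp [hy])
  · have iχ : Integrable fun y => v y * χ k y ^ 4 :=
      (hχ.scaled k).integrable (by fun_prop) (fun y hy => by simp [hy])
    rw [abs_mul, abs_of_pos (four_pos : (0 : ℝ) < 4), ← integral_sub iv iχ]
    have : |∫ y, v y * w y * ((1 / 2) ^ (k + 1 + 2) * y * χ (k + 1) y ^ 3 * e₁ (k + 1) y)| ≤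
        ∫ y, 2 * B * W * (v y - v y * χ k y ^ 4) := by
      rw [← Real.norm_eq_abs]
      refine norm_integral_le_of_norm_le ((iv.sub iχ).const_mul _)
        (Eventually.of_forall fun y => ?_)
      have hv := h.v_pos y
      have hw := h.w_pos y
      rw [Real.norm_eq_abs, abs_mul, abs_of_pos (mul_pos hv hw)]
      by_cases he : e₁ (k + 1) y = 0
      · have := mul_le_of_le_one_right hv.le ((hχ.scaled k).pow_four_le_one y)
        rw [he, mul_zero, abs_zero, mul_zero]
        exact mul_nonneg (by positivity) (by linarith)
      · rw [hχ.eq_zero_of_succ k y he]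
        calc _ ≤ v y * W * (2 * B) := by
              gcongr
              exacts [hW y, hs.abs_first_moment_le y]
          _ = _ := by ring
    rw [integral_const_mul] at this
    linarith

lemma exists_flux_deriv_ne_zero (h : PressureProfile p v w L L₂ L₃) {χ e₁ e₂ : ℕ → ℝ → ℝ}
    (hχ : CutoffSequence B χ e₁ e₂) (hW : ∀ y, w y ≤ W) (iv : Integrable v)
    (iL : Integrable fun y => v y * L y ^ 2) (hJ : 0 < ∫ y, v y * L y ^ 2) {G₂ : ℝ → ℝ}
    (hG₂ : Continuous G₂)
    (hG : ∀ y, HasDerivAt (fun z => v z * (p * L z * L₂ z + w z * L₃ z)) (G₂ y) y) :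
    ∃ y, G₂ y ≠ 0 := by
  by_contra! h0
  have cv := h.continuous_v
  have cw := h.continuous_w
  have cL₂ := h.continuous_L₂
  have hp := h.one_lt
  have hpos : ∀ y, 0 ≤ v y * w y * L₂ y ^ 2 := fun y => by
    have := h.v_pos y
    have := h.w_pos y
    positivity
  set K := fun k => ∫ y, v y * w y * L₂ y ^ 2 * χ k y ^ 4 with hK
  set C := (4 * p * B ^ 2 * W) * (∫ y, v y * L y ^ 2) + (128 * B ^ 4 * W ^ 3) * ∫ y, v y with hC
  have hbd : ∀ k, (p - 1 - (1 / 2) ^ (k + 2) * (4 * p)) * K k ≤ (1 / 2) ^ (k + 2) * C := fun k => by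
    have h1 := h.integral_entropy_flux (hχ.scaled k) hG₂ hG
    have h2 := h.abs_entropy_flux_error_le (hχ.scaled k) hW iv iL
    simp only [h0, mul_zero, zero_mul, integral_zero] at h1
    have h3 := (abs_le.1 h2).1
    rw [hC]
    simp only [hK]
    linarith
  have hlim1 : Tendsto (fun k : ℕ => (1 / 2 : ℝ) ^ (k + 2) * C) atTop (nhds 0) := by
    simpa using tendsto_half_pow_add_two.mul_const C
  have hK0 : ∀ k, K k = 0 := fun j => by
    refine le_antisymm ?_ (integral_nonneg fun y =>
      mul_nonneg (hpos y) (pow_nonneg ((hχ.scaled j).nonneg y) 4))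
    have hlim2 : Tendsto (fun k : ℕ => (p - 1 - (1 / 2) ^ (k + 2) * (4 * p)) * K j) atTop
        (nhds ((p - 1) * K j)) := by
      have := ((tendsto_half_pow_add_two.mul_const (4 * p)).const_sub (p - 1)).mul_const (K j)
      simpa using this
    have hle : (p - 1) * K j ≤ 0 := by
      refine le_of_tendsto_of_tendsto hlim2 hlim1 ?_
      have h4 : Tendsto (fun k : ℕ => p - 1 - (1 / 2 : ℝ) ^ (k + 2) * (4 * p)) atTop
          (nhds (p - 1)) := by
        simpa using (tendsto_half_pow_add_two.mul_const (4 * p)).const_sub (p - 1)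
      filter_upwards [eventually_ge_atTop j, h4.eventually (lt_mem_nhds (sub_pos.2 hp))] with k hk
        hk'
      refine (mul_le_mul_of_nonneg_left ?_ hk'.le).trans (hbd k)
      exact hχ.integral_mono (by fun_prop) hpos hk
    nlinarith
  have hL₂ : ∀ y, L₂ y = 0 := fun y => by
    obtain ⟨k, hk⟩ := (hχ.eventually_eq_one y).exists
    have cχ := (hχ.scaled k).continuous
    by_contra hne
    refine (Continuous.integral_pos_of_hasCompactSupport_nonneg_nonzero (μ := volume) (x := y)
      (f := fun y => v y * w y * L₂ y ^ 2 * χ k y ^ 4) (by fun_prop)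
      ((hχ.scaled k).hasCompactSupport fun z hz => by simp [hz]) (fun z => mul_nonneg (hpos z)
        (pow_nonneg ((hχ.scaled k).nonneg z) 4)) ?_).ne' (hK0 k)
    simp [hk, (h.v_pos y).ne', (h.w_pos y).ne', hne]
  have hLc : ∀ y, L y = L 0 := fun y =>
    is_const_of_deriv_eq_zero (fun z => (h.hasDerivAt_L z).differentiableAt)
      (fun z => (h.hasDerivAt_L z).deriv.trans (hL₂ z)) y 0
  have hwaff : ∀ y, w y = w 0 + (p - 1) * L 0 * y := fun y => by
    have := is_const_of_deriv_eq_zero (f := fun z => w z - (p - 1) * L 0 * z)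
      (fun z => ((h.hasDerivAt_w z).sub ((hasDerivAt_id z).const_mul _)).differentiableAt)
      (fun z => by
        refine ((h.hasDerivAt_w z).sub ((hasDerivAt_id z).const_mul _)).deriv.trans ?_
        rw [hLc z]
        ring) y 0
    simp only [mul_zero, sub_zero] at this
    linarith
  by_cases hL0 : L 0 = 0
  · simp [hLc, hL0] at hJ
  · have h1 := h.w_pos (-(w 0 / ((p - 1) * L 0)))
    rw [hwaff] at h1
    have h2 : (p - 1) * L 0 ≠ 0 := mul_ne_zero (sub_pos.2 hp).ne' hL0
    rw [mul_neg, mul_div_cancel₀ _ h2, add_neg_cancel] at h1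
    exact lt_irrefl _ h1

end PressureProfile

namespace SmoothStrip

variable {s : Set ℝ} {f g : ℝ → ℝ → ℝ}

lemma pow (hf : SmoothStrip s f) (n : ℕ) : SmoothStrip s (fun y τ => f y τ ^ n) :=
  ContDiffOn.pow hf n

lemma const_mul (hf : SmoothStrip s f) (c : ℝ) : SmoothStrip s (fun y τ => c * f y τ) :=
  ContDiffOn.mul contDiffOn_const hf

lemma div (hf : SmoothStrip s f) (hg : SmoothStrip s g) (h0 : ∀ y, ∀ τ ∈ s, g y τ ≠ 0) :
    SmoothStrip s (fun y τ => f y τ / g y τ) :=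
  ContDiffOn.div hf hg fun x hx => h0 x.1 x.2 hx.2

end SmoothStrip

/-- A solution on the time set `s` of the rescaled equation with `w = v ^ (p - 1)`,
`L = ∂_y (ln_p v)` and `J` twice the generalized Fisher information. -/
structure PressureFlow (p κ : ℝ) (s : Set ℝ) (v w L : ℝ → ℝ → ℝ) (J : ℝ → ℝ) : Prop where
  isOpen : IsOpen s
  smooth_v : SmoothStrip s v
  smooth_w : SmoothStrip s w
  smooth_L : SmoothStrip s L
  drift_nonneg : 0 ≤ κ
  profile : ∀ τ ∈ s, PressureProfile p (fun y => v y τ) (fun y => w y τ) (fun y => L y τ)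
    (fun y => pdy L y τ) (fun y => pdy (pdy L) y τ)
  pdt_w : ∀ y, ∀ τ ∈ s, pdt w y τ = (p - 1) * w y τ * pdt v y τ / v y τ
  pdt_L : ∀ y, ∀ τ ∈ s, pdt L y τ = pdy (fun z t => w z t * pdt v z t / v z t) y τ
  pde : ∀ y, ∀ τ ∈ s, pdt v y τ =
    -(2 / J τ * pdy (pdy fun z t => v z t * w z t * pdy L z t) y τ) +
      κ * (v y τ + y * (v y τ * L y τ / w y τ))
  integrable_v : ∀ τ ∈ s, Integrable fun y => v y τ
  integral_v : ∀ τ ∈ s, ∫ y, v y τ = 1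
  integrable_sq : ∀ τ ∈ s, Integrable fun y => v y τ * L y τ ^ 2
  integral_sq : ∀ τ ∈ s, ∫ y, v y τ * L y τ ^ 2 = J τ
  fisher_pos : ∀ τ ∈ s, 0 < J τ
  weight_le : ∀ τ ∈ s, ∀ y, w y τ ≤ 1 + p / 2 * (1 + J τ)

namespace PressureFlow

variable {p κ B ρ : ℝ} {s : Set ℝ} {v w L : ℝ → ℝ → ℝ} {J : ℝ → ℝ} {χ e₁ e₂ : ℝ → ℝ}
  (h : PressureFlow p κ s v w L J)
include h

lemma smooth_flux : SmoothStrip s fun z t => v z t * w z t * pdy L z t :=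
  (h.smooth_v.mul h.smooth_w).mul (h.smooth_L.pdy h.isOpen)

lemma hasDerivAt_flux {τ : ℝ} (hτ : τ ∈ s) (y : ℝ) :
    HasDerivAt (fun z => v z τ * (p * L z τ * pdy L z τ + w z τ * pdy (pdy L) z τ))
      (pdy (pdy fun z t => v z t * w z t * pdy L z t) y τ) y := by
  have hP := h.profile τ hτ
  have heq : (fun z => v z τ * (p * L z τ * pdy L z τ + w z τ * pdy (pdy L) z τ)) =
      fun z => pdy (fun z t => v z t * w z t * pdy L z t) z τ := funext fun z => by
    have hw := (hP.w_pos z).ne'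
    have h1 := ((hP.hasDerivAt_v z).mul (hP.hasDerivAt_w z)).mul (hP.hasDerivAt_L₂ z)
    refine (h1.deriv.trans ?_).symm
    simp only [Pi.mul_apply]
    field_simp
    ring
  rw [heq]
  exact (h.smooth_flux.pdy h.isOpen).hasDerivAt_pdy h.isOpen y hτ

lemma continuous_flux_deriv {τ : ℝ} (hτ : τ ∈ s) :
    Continuous fun y => pdy (pdy fun z t => v z t * w z t * pdy L z t) y τ :=
  ((h.smooth_flux.pdy h.isOpen).pdy h.isOpen).continuous_fst hτ

lemma smooth_rate : SmoothStrip s fun z t => w z t * pdt v z t / v z t :=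
  (h.smooth_w.mul (h.smooth_v.pdt h.isOpen)).div h.smooth_v
    fun y τ hτ => ((h.profile τ hτ).v_pos y).ne'

lemma smooth_entropyProduction :
    SmoothStrip s fun y τ => p * L y τ * pdy L y τ + w y τ * pdy (pdy L) y τ :=
  ((h.smooth_L.const_mul p).mul (h.smooth_L.pdy h.isOpen)).add
    (h.smooth_w.mul ((h.smooth_L.pdy h.isOpen).pdy h.isOpen))

lemma hasDerivAt_integral_entropy (hχ : ScaledCutoff B ρ χ e₁ e₂)
    (hχs : ContDiff ℝ (⊤ : ℕ∞) χ) {τ : ℝ} (hτ : τ ∈ s) :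
    HasDerivAt (fun t => ∫ y, v y t * w y t * χ y ^ 4)
      (∫ y, p * w y τ * pdt v y τ * χ y ^ 4) τ := by
  have hf : SmoothStrip s fun y t => v y t * w y t * χ y ^ 4 :=
    (h.smooth_v.mul h.smooth_w).mul (SmoothStrip.of_fst (hχs.pow 4))
  refine (hf.hasDerivAt_integral (k := Icc (-(2 / ρ)) (2 / ρ)) h.isOpen isCompact_Icc (fun y hy t => by
    simp [hχ.eq_zero_of_notMem y hy]) hτ).congr_deriv ?_
  refine integral_congr_ae (Eventually.of_forall fun y => ?_)
  have hv := ((h.profile τ hτ).v_pos y).ne'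
  refine ((((h.smooth_v.hasDerivAt_pdt h.isOpen y hτ).mul
    (h.smooth_w.hasDerivAt_pdt h.isOpen y hτ)).mul_const (χ y ^ 4)).deriv).trans ?_
  rw [h.pdt_w y τ hτ]
  field_simp
  ring

lemma hasDerivAt_integral_fisher (hχ : ScaledCutoff B ρ χ e₁ e₂)
    (hχs : ContDiff ℝ (⊤ : ℕ∞) χ) {τ : ℝ} (hτ : τ ∈ s) :
    HasDerivAt (fun t => 1 / 2 * ∫ y, v y t * L y t ^ 2 * χ y ^ 4)
      (∫ y, (1 / 2 * pdt v y τ * L y τ ^ 2 + v y τ * L y τ *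
        pdy (fun z t => w z t * pdt v z t / v z t) y τ) * χ y ^ 4) τ := by
  have hf : SmoothStrip s fun y t => v y t * L y t ^ 2 * χ y ^ 4 :=
    (h.smooth_v.mul (h.smooth_L.pow 2)).mul (SmoothStrip.of_fst (hχs.pow 4))
  refine ((hf.hasDerivAt_integral (k := Icc (-(2 / ρ)) (2 / ρ)) h.isOpen isCompact_Icc (fun y hy t => by
    simp [hχ.eq_zero_of_notMem y hy]) hτ).const_mul (1 / 2)).congr_deriv ?_
  rw [← integral_const_mul]
  refine integral_congr_ae (Eventually.of_forall fun y => ?_)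
  have h1 := (((h.smooth_v.hasDerivAt_pdt h.isOpen y hτ).mul
    ((h.smooth_L.hasDerivAt_pdt h.isOpen y hτ).pow 2)).mul_const (χ y ^ 4)).deriv
  dsimp only
  rw [← h.pdt_L y τ hτ]
  refine (congrArg (fun x => 1 / 2 * x) h1).trans ?_
  simp only [Pi.pow_apply]
  push_cast
  ring

lemma continuousOn_integral (hχ : ScaledCutoff B ρ χ e₁ e₂)
    (hχs : ContDiff ℝ (⊤ : ℕ∞) χ) {f : ℝ → ℝ → ℝ} (hf : SmoothStrip s f) :
    ContinuousOn (fun t => ∫ y, f y t * χ y ^ 4) s :=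
  (hf.mul (SmoothStrip.of_fst (hχs.pow 4))).continuousOn_integral
    (k := Icc (-(2 / ρ)) (2 / ρ)) h.isOpen isCompact_Icc
    fun y hy t => by simp [hχ.eq_zero_of_notMem y hy]

lemma contDiffAt_fisher {χ e₁ e₂ : ℕ → ℝ → ℝ} (hχ : CutoffSequence B χ e₁ e₂)
    {τ : ℝ} (hτ : τ ∈ s) : ContDiffAt ℝ 1 J τ := by
  have hP := h.profile τ hτ
  obtain ⟨y, hy⟩ := hP.exists_flux_deriv_ne_zero hχ (h.weight_le τ hτ) (h.integrable_v τ hτ)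
    (h.integrable_sq τ hτ) (by rw [h.integral_sq τ hτ]; exact h.fisher_pos τ hτ)
    (h.continuous_flux_deriv hτ) (h.hasDerivAt_flux hτ)
  have hF := (h.smooth_flux.pdy h.isOpen).pdy h.isOpen
  set F := pdy (pdy fun z t => v z t * w z t * pdy L z t) with hFdef
  have sec : ∀ {f : ℝ → ℝ → ℝ}, SmoothStrip s f → ContDiffAt ℝ 1 (fun t => f y t) τ :=
    fun {f} hf => ContDiffAt.comp τ (f := fun t : ℝ => (y, t)) (g := Function.uncurry f)
      ((hf.contDiffAt h.isOpen y hτ).of_le (by exact_mod_cast le_top))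
      (contDiffAt_const.prodMk contDiffAt_id)
  have hpde : ∀ t ∈ s, 2 / J t * F y t =
      κ * (v y t + y * (v y t * L y t / w y t)) - pdt v y t := fun t ht => by
    rw [h.pde y t ht]
    ring
  have hden : ContDiffAt ℝ 1
      (fun t => κ * (v y t + y * (v y t * L y t / w y t)) - pdt v y t) τ :=
    (contDiffAt_const.mul ((sec h.smooth_v).add (contDiffAt_const.mul
      (((sec h.smooth_v).mul (sec h.smooth_L)).div (sec h.smooth_w)
        (hP.w_pos y).ne')))).sub (sec (h.smooth_v.pdt h.isOpen))
  have hJ : J =ᶠ[nhds τ] fun t => 2 * F y t /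
      (κ * (v y t + y * (v y t * L y t / w y t)) - pdt v y t) := by
    filter_upwards [(sec hF).continuousAt.eventually_ne hy, h.isOpen.mem_nhds hτ] with t ht hts
    rw [← hpde t hts]
    have := (h.fisher_pos t hts).ne'
    field_simp
  refine ((contDiffAt_const.mul (sec hF)).div hden ?_).congr_of_eventuallyEq hJ
  rw [← hpde τ hτ]
  exact mul_ne_zero (div_pos two_pos (h.fisher_pos τ hτ)).ne' hy

end PressureFlow

lemma mul_le_of_limit_deriv_le {H H' : ℕ → ℝ → ℝ} {D F : ℝ → ℝ} {a b c C Λ : ℝ}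
    (hD : ContinuousOn D (Ioo a b))
    (hH : ∀ᶠ k in atTop, ∀ t ∈ Ioo a b, HasDerivAt (H k) (H' k t) t ∧ H' k t ≤ C - c * D t)
    (hlim : ∀ t ∈ Ioo a b, Tendsto (fun k => H k t) atTop (nhds (F t)))
    (hF : ∀ t₁ ∈ Ioo a b, ∀ t₂ ∈ Ioo a b, t₁ ≤ t₂ → -Λ * (t₂ - t₁) ≤ F t₂ - F t₁)
    {t : ℝ} (ht : t ∈ Ioo a b) : c * D t ≤ C + Λ := by
  by_contra! hlt
  obtain ⟨m, hm1, hm2⟩ := exists_between hlt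
  have hev : ∀ᶠ u in nhds t, u ∈ Ioo a b ∧ m < c * D u :=
    Filter.Eventually.and (isOpen_Ioo.mem_nhds ht) ((continuousAt_const.mul
      (hD.continuousAt (isOpen_Ioo.mem_nhds ht))).eventually (lt_mem_nhds hm2))
  obtain ⟨δ, hδ, hball⟩ := Metric.nhds_basis_closedBall.mem_iff.1 hev
  have hmem : ∀ u ∈ Icc t (t + δ), u ∈ Ioo a b ∧ m < c * D u := fun u hu =>
    hball (by rw [Real.closedBall_eq_Icc]; exact ⟨by linarith [hu.1], hu.2⟩)
  have hend := (hmem (t + δ) ⟨by linarith, le_rfl⟩).1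
  have hk : ∀ᶠ k in atTop, H k (t + δ) - H k t ≤ (C - m) * δ := by
    filter_upwards [hH] with k hk
    obtain ⟨u, hu, hu'⟩ := exists_hasDerivAt_eq_slope (H k) (H' k) (by linarith : t < t + δ)
      (fun u hu => (hk u (hmem u hu).1).1.continuousAt.continuousWithinAt)
      (fun u hu => (hk u (hmem u (Ioo_subset_Icc_self hu)).1).1)
    have h1 := hmem u (Ioo_subset_Icc_self hu)
    have h2 := (hk u h1.1).2
    rw [eq_div_iff (by linarith)] at hu'
    rw [← hu', add_sub_cancel_left]
    exact mul_le_mul_of_nonneg_right (by linarith) hδ.le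
  have h3 := le_of_tendsto ((hlim _ hend).sub (hlim _ ht)) hk
  have h4 := hF t ht _ hend (by linarith)
  rw [add_sub_cancel_left] at h4
  nlinarith

namespace PressureFlow

variable {p κ B : ℝ} {s : Set ℝ} {v w L : ℝ → ℝ → ℝ} {J : ℝ → ℝ} {χ e₁ e₂ : ℕ → ℝ → ℝ}
  (h : PressureFlow p κ s v w L J)
include h

lemma integral_hessian_nonneg {t : ℝ} (ht : t ∈ s) (φ : ℝ → ℝ) :
    0 ≤ ∫ y, v y t * w y t * pdy L y t ^ 2 * φ y ^ 4 :=
  integral_nonneg fun y => by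
    have := (h.profile t ht).v_pos y
    have := (h.profile t ht).w_pos y
    dsimp only at *
    positivity

variable (hχ : CutoffSequence B χ e₁ e₂)
include hχ

lemma integral_entropy_le {W : ℝ} {t : ℝ} (ht : t ∈ s) (hW : ∀ y, w y t ≤ W) (k : ℕ) :
    ∫ y, v y t * w y t * χ k y ^ 4 ≤ W := by
  have hP := h.profile t ht
  have cv := hP.continuous_v
  have cw := hP.continuous_w
  have cχ := (hχ.scaled k).continuous
  calc _ ≤ ∫ y, W * v y t := by
        refine integral_mono ((hχ.scaled k).integrable (by fun_prop) fun y hy => by simp [hy])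
          ((h.integrable_v t ht).const_mul W) fun y => ?_
        have h1 := (hχ.scaled k).pow_four_le_one y
        have h2 := hP.v_pos y
        have h3 := hP.w_pos y
        have h4 := hW y
        dsimp only at *
        calc _ ≤ v y t * w y t := mul_le_of_le_one_right (by positivity) h1
          _ ≤ _ := by rw [mul_comm]; gcongr
    _ = W := by rw [integral_const_mul, h.integral_v t ht, mul_one]

lemma entropy_rate {W : ℝ} {t : ℝ} (ht : t ∈ s) (hW : ∀ y, w y t ≤ W) (k : ℕ) :
    ∃ r d : ℝ, ∫ y, p * w y t * pdt v y t * χ (k + 1) y ^ 4 =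
      -(2 / J t * p) * ((p - 1) * (∫ y, v y t * w y t * pdy L y t ^ 2 * χ (k + 1) y ^ 4) + r) +
        κ * ((p - 1) * (∫ y, v y t * w y t * χ (k + 1) y ^ 4) - d) ∧
      |r| ≤ (1 / 2) ^ (k + 1 + 2) *
        ((4 * p) * (∫ y, v y t * w y t * pdy L y t ^ 2 * χ (k + 1) y ^ 4) +
        ((4 * p * B ^ 2 * W) * J t + 128 * B ^ 4 * W ^ 3)) ∧
      |d| ≤ 8 * B * W * (1 - ∫ y, v y t * χ k y ^ 4) := by
  obtain ⟨r, d, h1, h2, h3⟩ := (h.profile t ht).integral_entropy_rate hχ hW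
    (h.integrable_v t ht) (h.integrable_sq t ht) (h.continuous_flux_deriv ht)
    (h.hasDerivAt_flux ht) (fun y => h.pde y t ht) k
  refine ⟨r, d, h1, ?_, ?_⟩
  · rwa [h.integral_v t ht, h.integral_sq t ht, mul_one, add_assoc (4 * p * _)] at h2
  · rwa [h.integral_v t ht] at h3

lemma fisher_rate_le {W : ℝ} {t : ℝ} (ht : t ∈ s) (hW : ∀ y, w y t ≤ W) (k : ℕ) :
    ∫ y, (1 / 2 * pdt v y t * L y t ^ 2 + v y t * L y t *
        pdy (fun z t => w z t * pdt v z t / v z t) y t) * χ k y ^ 4 ≤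
      -(2 / J t / 2) * (∫ y, v y t *
        (p * L y t * pdy L y t + w y t * pdy (pdy L) y t) ^ 2 * χ k y ^ 4) +
      2 / J t * ((1 / 2) ^ (k + 2)) ^ 2 * (960 * p ^ 2 * B ^ 2 * W *
        (∫ y, v y t * w y t * pdy L y t ^ 2 * χ (k + 1) y ^ 4) +
        408 * p ^ 2 * B ^ 4 * W ^ 2 * J t) + κ * (p + 4 * B) * J t := by
  have := (h.profile t ht).integral_fisher_flux_le (hχ.scaled k) (hχ.scaled (k + 1))
    (fun y => hχ.pow_le_pow_succ two_ne_zero k y) hW (h.integrable_sq t ht)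
    (div_nonneg zero_le_two (h.fisher_pos t ht).le) h.drift_nonneg (h.continuous_flux_deriv ht)
    (h.hasDerivAt_flux ht) (fun y => h.pde y t ht)
    (fun y => h.smooth_rate.hasDerivAt_pdy h.isOpen y ht)
    ((h.smooth_rate.pdy h.isOpen).continuous_fst ht)
  rwa [h.integral_sq t ht] at this

/-- The time derivative of the cut-off Fisher information, corrected by a small multiple of the
cut-off entropy, is bounded by minus the entropy production. -/
lemma exists_corrected_rate_le {W c₀ c₁ j₁ : ℝ} (hc₀ : 0 < c₀) {N : Set ℝ} (hN : N ⊆ s)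
    (hNc₀ : ∀ t ∈ N, c₀ ≤ 2 / J t) (hNc₁ : ∀ t ∈ N, 2 / J t ≤ c₁) (hNj : ∀ t ∈ N, J t ≤ j₁)
    (hNW : ∀ t ∈ N, ∀ y, w y t ≤ W) :
    ∃ lam C : ℝ, ∀ᶠ k in atTop, ∀ t ∈ N,
      (∫ y, (1 / 2 * pdt v y t * L y t ^ 2 + v y t * L y t *
        pdy (fun z t => w z t * pdt v z t / v z t) y t) * χ k y ^ 4) +
        lam * ((1 / 2) ^ (k + 2)) ^ 2 * (∫ y, p * w y t * pdt v y t * χ (k + 1) y ^ 4) ≤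
      C - c₀ / 2 * ∫ y, v y t *
        (p * L y t * pdy L y t + w y t * pdy (pdy L) y t) ^ 2 * χ k y ^ 4 := by
  rcases N.eq_empty_or_nonempty with rfl | ⟨t₀, ht₀⟩
  · exact ⟨0, 0, Eventually.of_forall fun k t ht => ht.elim⟩
  have hp : 1 < p := (h.profile t₀ (hN ht₀)).one_lt
  have hB : 1 ≤ B := (hχ.scaled 0).one_le
  have hW0 : 0 ≤ W := ((h.profile t₀ (hN ht₀)).w_pos 0).le.trans (hNW t₀ ht₀ 0)
  have hκ := h.drift_nonneg
  have hj1 : 0 ≤ j₁ := (h.fisher_pos t₀ (hN ht₀)).le.trans (hNj t₀ ht₀)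
  have hc1 : 0 ≤ c₁ := hc₀.le.trans ((hNc₀ t₀ ht₀).trans (hNc₁ t₀ ht₀))
  have he : 0 < p - 1 := by linarith
  set A₁ := (4 * p * B ^ 2 * W) * j₁ + 128 * B ^ 4 * W ^ 3 with hA₁
  set A₂ := 960 * p ^ 2 * B ^ 2 * W with hA₂
  set C₂ := c₁ * p * A₁ + κ * ((p - 1) * W + 8 * B * W) with hC₂
  set lam := c₁ * A₂ / (c₀ * p * ((p - 1) / 2)) with hlam
  have hA₁0 : 0 ≤ A₁ := by positivity
  have hA₂0 : 0 ≤ A₂ := by positivity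
  have hC₂0 : 0 ≤ C₂ := by positivity
  have hlam0 : 0 ≤ lam := by positivity
  have hlam' : lam * (c₀ * p * ((p - 1) / 2)) = c₁ * A₂ := by
    rw [hlam]; field_simp
  refine ⟨lam, c₁ * (408 * p ^ 2 * B ^ 4 * W ^ 2 * j₁) + κ * (p + 4 * B) * j₁ + lam * C₂, ?_⟩
  have hsmall : ∀ᶠ k : ℕ in atTop, (1 / 2 : ℝ) ^ (k + 1 + 2) * (4 * p) < (p - 1) / 2 :=
    ((((tendsto_half_pow_add_two.comp (tendsto_add_atTop_nat 1)).mul_const (4 * p)).congr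
      fun k => rfl).eventually (gt_mem_nhds (by rw [zero_mul]; linarith)))
  filter_upwards [hsmall] with k hk t ht
  have hts := hN ht
  have hrate := h.fisher_rate_le hχ hts (hNW t ht) k
  obtain ⟨r, d, hE, hr, hd⟩ := h.entropy_rate hχ hts (hNW t ht) k
  have hK := h.integral_hessian_nonneg hts (χ (k + 1))
  have hE0 := h.integral_entropy_le hχ hts (hNW t ht) (k + 1)
  have hD0 : 0 ≤ ∫ y, v y t *
      (p * L y t * pdy L y t + w y t * pdy (pdy L) y t) ^ 2 * χ k y ^ 4 :=
    integral_nonneg fun y => by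
      have := (h.profile t hts).v_pos y
      dsimp only at *
      positivity
  have hM : 0 ≤ ∫ y, v y t * χ k y ^ 4 :=
    integral_nonneg fun y => by
      have := (h.profile t hts).v_pos y
      dsimp only at *
      positivity
  have hρ0 : (0 : ℝ) ≤ ((1 / 2) ^ (k + 2)) ^ 2 := by positivity
  have hρ1 : ((1 / 2 : ℝ) ^ (k + 2)) ^ 2 ≤ 1 :=
    pow_le_one₀ (by positivity) (pow_le_one₀ (by norm_num) (by norm_num))
  have hρ' : (1 / 2 : ℝ) ^ (k + 1 + 2) ≤ 1 := pow_le_one₀ (by norm_num) (by norm_num)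
  have hρ'0 : (0 : ℝ) ≤ (1 / 2) ^ (k + 1 + 2) := by positivity
  have hcl := hNc₀ t ht
  have hcu := hNc₁ t ht
  have hJ := hNj t ht
  have hJ0 := (h.fisher_pos t hts).le
  generalize (∫ y, v y t * (p * L y t * pdy L y t + w y t * pdy (pdy L) y t) ^ 2 * χ k y ^ 4) = D
    at *
  generalize (∫ y, v y t * w y t * pdy L y t ^ 2 * χ (k + 1) y ^ 4) = K at *
  generalize (∫ y, v y t * w y t * χ (k + 1) y ^ 4) = E at *
  generalize (∫ y, v y t * χ k y ^ 4) = M at *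
  generalize 2 / J t = c at *
  generalize ((1 / 2 : ℝ) ^ (k + 2)) ^ 2 = σ at *
  generalize (1 / 2 : ℝ) ^ (k + 1 + 2) = σ' at *
  have hc : 0 ≤ c := hc₀.le.trans hcl
  have hE' : ∫ y, p * w y t * pdt v y t * χ (k + 1) y ^ 4 ≤
      -(c₀ * p * ((p - 1) / 2)) * K + C₂ := by
    have h1 : -((p - 1) * K + r) ≤ -((p - 1) / 2 * K) + A₁ := by
      have h2 := (abs_le.1 hr).1
      have h3 : σ' * (4 * p) * K ≤ (p - 1) / 2 * K := by gcongr
      have h4 : σ' * ((4 * p * B ^ 2 * W) * J t + 128 * B ^ 4 * W ^ 3) ≤ 1 * A₁ := by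
        rw [hA₁]; gcongr
      linarith
    have h5 : -d ≤ 8 * B * W := by
      have h6 := (abs_le.1 hd).1
      have h7 : 8 * B * W * (1 - M) ≤ 8 * B * W * 1 := by gcongr; linarith
      linarith
    rw [hE]
    calc _ = c * p * (-((p - 1) * K + r)) + κ * ((p - 1) * E + -d) := by ring
      _ ≤ c * p * (-((p - 1) / 2 * K) + A₁) + κ * ((p - 1) * W + 8 * B * W) := by gcongr
      _ = -(c * p * ((p - 1) / 2)) * K + c * p * A₁ + κ * ((p - 1) * W + 8 * B * W) := by ring
      _ ≤ -(c₀ * p * ((p - 1) / 2)) * K + c₁ * p * A₁ + κ * ((p - 1) * W + 8 * B * W) := by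
        gcongr
      _ = _ := by ring
  have h8 : lam * σ * (∫ y, p * w y t * pdt v y t * χ (k + 1) y ^ 4) ≤
      -(c₁ * σ * (A₂ * K)) + lam * C₂ :=
    calc _ ≤ lam * σ * (-(c₀ * p * ((p - 1) / 2)) * K + C₂) := by gcongr
      _ = -(lam * (c₀ * p * ((p - 1) / 2)) * σ * K) + lam * σ * C₂ := by ring
      _ ≤ -(lam * (c₀ * p * ((p - 1) / 2)) * σ * K) + lam * 1 * C₂ := by gcongr
      _ = _ := by rw [hlam']; ring
  have h9 : c * σ * (A₂ * K + 408 * p ^ 2 * B ^ 4 * W ^ 2 * J t) ≤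
      c₁ * σ * (A₂ * K) + c₁ * (408 * p ^ 2 * B ^ 4 * W ^ 2 * j₁) :=
    calc _ ≤ c₁ * σ * (A₂ * K + 408 * p ^ 2 * B ^ 4 * W ^ 2 * j₁) := by gcongr
      _ = c₁ * σ * (A₂ * K) + c₁ * σ * (408 * p ^ 2 * B ^ 4 * W ^ 2 * j₁) := by ring
      _ ≤ c₁ * σ * (A₂ * K) + c₁ * 1 * (408 * p ^ 2 * B ^ 4 * W ^ 2 * j₁) := by gcongr
      _ = _ := by ring
  have h10 : κ * (p + 4 * B) * J t ≤ κ * (p + 4 * B) * j₁ := by gcongr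
  have h11 : -(c / 2) * D ≤ -(c₀ / 2 * D) := by
    rw [neg_mul]; gcongr
  linarith

end PressureFlow

namespace PressureFlow

variable {p κ B : ℝ} {s : Set ℝ} {v w L : ℝ → ℝ → ℝ} {J : ℝ → ℝ} {χ e₁ e₂ : ℕ → ℝ → ℝ}
  (h : PressureFlow p κ s v w L J) (hχ : CutoffSequence B χ e₁ e₂)
include h hχ

lemma exists_Ioo_fisher_bounds {τ : ℝ} (hτ : τ ∈ s) :
    ∃ a b j₀ j₁ Λ : ℝ, τ ∈ Ioo a b ∧ Ioo a b ⊆ s ∧ 0 < j₀ ∧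
      (∀ t ∈ Ioo a b, j₀ ≤ J t ∧ J t ≤ j₁) ∧
      ∀ t₁ ∈ Ioo a b, ∀ t₂ ∈ Ioo a b, t₁ ≤ t₂ → -Λ * (t₂ - t₁) ≤ J t₂ - J t₁ := by
  have hJ := h.contDiffAt_fisher hχ hτ
  have hpos := h.fisher_pos τ hτ
  obtain ⟨Λ, N, hN, hLip⟩ := hJ.exists_lipschitzOnWith
  have hev : ∀ᶠ t in nhds τ, (t ∈ s ∧ t ∈ N) ∧ (J τ / 2 < J t ∧ J t < 2 * J τ) :=
    (Filter.Eventually.and (h.isOpen.mem_nhds hτ) hN).and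
      ((hJ.continuousAt.eventually (lt_mem_nhds (by linarith))).and
        (hJ.continuousAt.eventually (gt_mem_nhds (by linarith))))
  obtain ⟨a, b, hab, hsub⟩ := mem_nhds_iff_exists_Ioo_subset.1 hev
  refine ⟨a, b, J τ / 2, 2 * J τ, Λ, hab, fun t ht => (hsub ht).1.1, by linarith,
    fun t ht => ⟨(hsub ht).2.1.le, (hsub ht).2.2.le⟩, fun t₁ h₁ t₂ h₂ h12 => ?_⟩
  have := hLip.dist_le_mul t₂ (hsub h₂).1.2 t₁ (hsub h₁).1.2
  rw [Real.dist_eq, Real.dist_eq, abs_of_nonneg (sub_nonneg.2 h12)] at this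
  linarith [(abs_le.1 this).1]

lemma eventually_entropyProduction_le {τ : ℝ} (hτ : τ ∈ s) :
    ∃ W j₁ c₁ D₁ : ℝ, ∀ᶠ t in nhds τ, t ∈ s ∧ (∀ y, w y t ≤ W) ∧ J t ≤ j₁ ∧ 2 / J t ≤ c₁ ∧
      ∀ k, ∫ y, v y t *
        (p * L y t * pdy L y t + w y t * pdy (pdy L) y t) ^ 2 * χ k y ^ 4 ≤ D₁ := by
  obtain ⟨a, b, j₀, j₁, Λ, hab, hs, hj₀, hJ, hΛ⟩ := h.exists_Ioo_fisher_bounds hχ hτ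
  have hj₁ : 0 < j₁ := hj₀.trans_le ((hJ τ hab).1.trans (hJ τ hab).2)
  have hp := (h.profile τ hτ).one_lt
  have hW : ∀ t ∈ Ioo a b, ∀ y, w y t ≤ 1 + p / 2 * (1 + j₁) := fun t ht y => by
    refine (h.weight_le t (hs ht) y).trans ?_
    gcongr
    exact (hJ t ht).2
  set W := 1 + p / 2 * (1 + j₁) with hWdef
  have hc₀ : 0 < 2 / j₁ := by positivity
  have hc₁ : ∀ t ∈ Ioo a b, 2 / J t ≤ 2 / j₀ := fun t ht =>
    div_le_div_of_nonneg_left zero_le_two hj₀ (hJ t ht).1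
  obtain ⟨lam, C, hrate⟩ := h.exists_corrected_rate_le hχ hc₀ hs
    (fun t ht => div_le_div_of_nonneg_left zero_le_two (hj₀.trans_le (hJ t ht).1) (hJ t ht).2)
    hc₁ (fun t ht => (hJ t ht).2) hW
  refine ⟨W, j₁, 2 / j₀, (C + Λ / 2) / (2 / j₁ / 2), ?_⟩
  filter_upwards [isOpen_Ioo.mem_nhds hab] with t ht
  refine ⟨hs ht, hW t ht, (hJ t ht).2, hc₁ t ht, fun k => ?_⟩
  rw [le_div_iff₀ (by positivity), mul_comm]
  have hE := fun (k : ℕ) (t : ℝ) (ht : t ∈ s) =>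
    h.hasDerivAt_integral_entropy (hχ.scaled k) (hχ.contDiff k) ht
  have hI := fun (k : ℕ) (t : ℝ) (ht : t ∈ s) =>
    h.hasDerivAt_integral_fisher (hχ.scaled k) (hχ.contDiff k) ht
  have hD : ContinuousOn (fun t => ∫ y, v y t *
      (p * L y t * pdy L y t + w y t * pdy (pdy L) y t) ^ 2 * χ k y ^ 4) s :=
    h.continuousOn_integral (hχ.scaled k) (hχ.contDiff k)
      (h.smooth_v.mul (h.smooth_entropyProduction.pow 2))
  refine mul_le_of_limit_deriv_le (c := 2 / j₁ / 2) (F := fun t => 1 / 2 * J t) (hD.mono hs)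
    (H := fun k t => (1 / 2 * ∫ y, v y t * L y t ^ 2 * χ k y ^ 4) +
      lam * ((1 / 2) ^ (k + 2)) ^ 2 * ∫ y, v y t * w y t * χ (k + 1) y ^ 4)
    (H' := fun k t => (∫ y, (1 / 2 * pdt v y t * L y t ^ 2 + v y t * L y t *
        pdy (fun z t => w z t * pdt v z t / v z t) y t) * χ k y ^ 4) +
        lam * ((1 / 2) ^ (k + 2)) ^ 2 * (∫ y, p * w y t * pdt v y t * χ (k + 1) y ^ 4))
    ?_ (fun t ht => ?_) (fun t₁ h₁ t₂ h₂ h12 => by linarith [hΛ t₁ h₁ t₂ h₂ h12]) ht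
  · filter_upwards [hrate, eventually_ge_atTop k] with n hn hkn t ht
    have hts := hs ht
    refine ⟨(hI n t hts).add ((hE (n + 1) t hts).const_mul _), (hn t ht).trans ?_⟩
    have hmono := hχ.integral_mono (f := fun y => v y t *
      (p * L y t * pdy L y t + w y t * pdy (pdy L) y t) ^ 2)
      ((h.smooth_v.mul (h.smooth_entropyProduction.pow 2)).continuous_fst hts)
      (fun y => mul_nonneg ((h.profile t hts).v_pos y).le (sq_nonneg _)) hkn
    gcongr
  · have hts := hs ht
    have h1 : Tendsto (fun k => ∫ y, v y t * L y t ^ 2 * χ k y ^ 4) atTop (nhds (J t)) := by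
      rw [← h.integral_sq t hts]
      exact hχ.tendsto_integral ((h.smooth_v.mul (h.smooth_L.pow 2)).continuous_fst hts)
        (h.integrable_sq t hts)
    have h2 : Tendsto (fun k : ℕ => lam * ((1 / 2 : ℝ) ^ (k + 2)) ^ 2 *
        ∫ y, v y t * w y t * χ (k + 1) y ^ 4) atTop (nhds 0) := by
      have h3 : Tendsto (fun k : ℕ => lam * ((1 / 2 : ℝ) ^ (k + 2)) ^ 2) atTop (nhds 0) := by
        simpa using (tendsto_half_pow_add_two.pow 2).const_mul lam
      refine h3.zero_mul_isBoundedUnder_le (isBoundedUnder_of ⟨W, fun k => ?_⟩)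
      rw [Function.comp_apply, Real.norm_of_nonneg (integral_nonneg fun y => ?_)]
      · exact h.integral_entropy_le hχ hts (hW t ht) (k + 1)
      · have := (h.profile t hts).v_pos y
        have := (h.profile t hts).w_pos y
        dsimp only at *
        positivity
    have h4 := (h1.const_mul (1 / 2)).add h2
    rwa [add_zero] at h4

lemma exists_tail_le {f : ℝ → ℝ → ℝ} (hf : SmoothStrip s f) (h0 : ∀ y, ∀ t ∈ s, 0 ≤ f y t)
    (hi : ∀ t ∈ s, Integrable fun y => f y t) {τ : ℝ} (hτ : τ ∈ s)
    (hF : ContinuousAt (fun t => ∫ y, f y t) τ) {ε : ℝ} (hε : 0 < ε) :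
    ∃ j, ∀ᶠ t in nhds τ, ∀ k, j ≤ k → (∫ y, f y t) - ∫ y, f y t * χ k y ^ 4 ≤ ε := by
  have h1 := (tendsto_const_nhds (x := ∫ y, f y τ)).sub
    (hχ.tendsto_integral (hf.continuous_fst hτ) (hi τ hτ))
  rw [sub_self] at h1
  obtain ⟨j, hj⟩ := (h1.eventually (gt_mem_nhds hε)).exists
  refine ⟨j, ?_⟩
  have hc : ContinuousAt (fun t => (∫ y, f y t) - ∫ y, f y t * χ j y ^ 4) τ :=
    hF.sub ((h.continuousOn_integral (hχ.scaled j) (hχ.contDiff j) hf).continuousAt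
      (h.isOpen.mem_nhds hτ))
  filter_upwards [hc.eventually (gt_mem_nhds hj), h.isOpen.mem_nhds hτ] with t ht hts k hk
  have := hχ.integral_mono (hf.continuous_fst hts) (fun y => h0 y t hts) hk
  linarith

end PressureFlow

namespace PressureFlow

variable {p κ B W j₁ c₁ D₁ : ℝ} {s : Set ℝ} {v w L : ℝ → ℝ → ℝ} {J : ℝ → ℝ}
  {χ e₁ e₂ : ℕ → ℝ → ℝ} (h : PressureFlow p κ s v w L J) (hχ : CutoffSequence B χ e₁ e₂)
  {t : ℝ} (ht : t ∈ s) (hW : ∀ y, w y t ≤ W)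
include h ht hW

lemma integrable_entropy : Integrable fun y => v y t * w y t := by
  have hP := h.profile t ht
  have cv := hP.continuous_v
  have cw := hP.continuous_w
  refine ((h.integrable_v t ht).const_mul W).mono' (by fun_prop)
    (Eventually.of_forall fun y => ?_)
  have h2 := hP.v_pos y
  have h3 := hP.w_pos y
  have h4 := hW y
  rw [Real.norm_of_nonneg (by positivity), mul_comm]
  gcongr

include hχ

lemma entropy_sub_le (k : ℕ) :
    (∫ y, v y t * w y t) - (∫ y, v y t * w y t * χ k y ^ 4) ≤
      W * (1 - ∫ y, v y t * χ k y ^ 4) := by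
  have hP := h.profile t ht
  have cv := hP.continuous_v
  have cw := hP.continuous_w
  have cχ := (hχ.scaled k).continuous
  have i1 : Integrable fun y => v y t * w y t * χ k y ^ 4 :=
    (hχ.scaled k).integrable (by fun_prop) fun y hy => by simp [hy]
  have i2 : Integrable fun y => v y t * χ k y ^ 4 :=
    (hχ.scaled k).integrable (by fun_prop) fun y hy => by simp [hy]
  rw [← h.integral_v t ht, ← integral_sub (h.integrable_entropy ht hW) i1,
    ← integral_sub (h.integrable_v t ht) i2, ← integral_const_mul]
  refine integral_mono ((h.integrable_entropy ht hW).sub i1)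
    (((h.integrable_v t ht).sub i2).const_mul W) fun y => ?_
  have h1 := sub_nonneg.2 ((hχ.scaled k).pow_four_le_one y)
  have h2 := hP.v_pos y
  have h4 := hW y
  dsimp only at *
  calc _ = w y t * (v y t * (1 - χ k y ^ 4)) := by ring
    _ ≤ W * (v y t * (1 - χ k y ^ 4)) := by gcongr
    _ = _ := by ring

variable (hj : J t ≤ j₁) (hD : ∀ k, ∫ y, v y t *
  (p * L y t * pdy L y t + w y t * pdy (pdy L) y t) ^ 2 * χ k y ^ 4 ≤ D₁)
include hj hD

lemma integral_hessian_le (k : ℕ) : ∫ y, v y t * w y t * pdy L y t ^ 2 * χ k y ^ 4 ≤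
    D₁ + (1 + 4 * B ^ 2 * W) * j₁ := by
  have := (h.profile t ht).integral_hessian_le (hχ.scaled k) hW (h.integrable_sq t ht)
  rw [h.integral_sq t ht] at this
  have hB := (hχ.scaled 0).one_le
  have hW0 : 0 ≤ W := ((h.profile t ht).w_pos 0).le.trans (hW 0)
  refine this.trans ?_
  gcongr
  exact hD k

lemma integrable_hessian : Integrable fun y => v y t * w y t * pdy L y t ^ 2 := by
  have hP := h.profile t ht
  have cv := hP.continuous_v
  have cw := hP.continuous_w
  have cL₂ := hP.continuous_L₂
  refine hχ.integrable_of_bound (by fun_prop) (fun y => ?_)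
    (h.integral_hessian_le hχ ht hW hj hD)
  have := hP.v_pos y
  have := hP.w_pos y
  positivity

lemma hessian_sub_le {θ : ℝ} (hθ : 0 < θ) (k : ℕ) :
    (∫ y, v y t * w y t * pdy L y t ^ 2) -
      (∫ y, v y t * w y t * pdy L y t ^ 2 * χ k y ^ 4) ≤
    θ * D₁ + θ⁻¹ * (J t - ∫ y, v y t * L y t ^ 2 * χ k y ^ 4) +
      2 * (1 / 2) ^ (k + 2) * (2 * (D₁ + (1 + 4 * B ^ 2 * W) * j₁) + 2 * B ^ 2 * W * j₁) := by
  have hP := h.profile t ht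
  have cv := hP.continuous_v
  have cw := hP.continuous_w
  have cL₂ := hP.continuous_L₂
  have hW0 : 0 ≤ W := (hP.w_pos 0).le.trans (hW 0)
  have hK := h.integral_hessian_le hχ ht hW hj hD
  refine le_of_tendsto ((hχ.tendsto_integral (by fun_prop)
    (h.integrable_hessian hχ ht hW hj hD)).sub_const _) ?_
  filter_upwards [eventually_ge_atTop k] with n hn
  have := hP.integral_hessian_sub_le (hχ.scaled k) (hχ.scaled n)
    (pow_le_pow_of_le_one (by norm_num) (by norm_num) (by lia))
    (fun y => hχ.monotone_pow_four y hn) (hχ.eq_zero_of_le hn) hW (h.integrable_sq t ht) hθ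
  rw [h.integral_sq t ht] at this
  refine this.trans ?_
  rw [two_mul (D₁ + _)]
  gcongr
  exacts [hD n, hK n, hK k]

lemma abs_entropy_rate_sub_le (hc : 2 / J t ≤ c₁) {θ : ℝ} (hθ : 0 < θ) {k : ℕ}
    (hk : (1 / 2) ^ (k + 1 + 2) ≤ θ)
    (hJk : J t - ∫ y, v y t * L y t ^ 2 * χ (k + 1) y ^ 4 ≤ θ ^ 2)
    (hM : 1 - ∫ y, v y t * χ k y ^ 4 ≤ θ) (hM' : 1 - ∫ y, v y t * χ (k + 1) y ^ 4 ≤ θ) :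
    |(∫ y, p * w y t * pdt v y t * χ (k + 1) y ^ 4) -
      (-(2 / J t * p) * ((p - 1) * ∫ y, v y t * w y t * pdy L y t ^ 2) +
        κ * ((p - 1) * ∫ y, v y t * w y t))| ≤
    θ * (c₁ * p * ((p - 1) * (D₁ + 1 + 2 * (2 * (D₁ + (1 + 4 * B ^ 2 * W) * j₁) +
        2 * B ^ 2 * W * j₁)) + ((4 * p) * (D₁ + (1 + 4 * B ^ 2 * W) * j₁) +
        ((4 * p * B ^ 2 * W) * j₁ + 128 * B ^ 4 * W ^ 3))) +
      κ * ((p - 1) * W + 8 * B * W)) := by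
  have hP := h.profile t ht
  have hp := hP.one_lt
  have hB := (hχ.scaled 0).one_le
  have hκ := h.drift_nonneg
  have hW0 : 0 ≤ W := (hP.w_pos 0).le.trans (hW 0)
  have hc1 : 0 ≤ c₁ := (div_nonneg zero_le_two (h.fisher_pos t ht).le).trans hc
  have hc0 : 0 ≤ 2 / J t := div_nonneg zero_le_two (h.fisher_pos t ht).le
  have he : 0 < p - 1 := by linarith
  have hj0 := (h.fisher_pos t ht).le
  obtain ⟨r, d, hE, hr, hd⟩ := h.entropy_rate hχ ht hW k
  have hK := h.integral_hessian_le hχ ht hW hj hD (k + 1)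
  have hKs := h.hessian_sub_le hχ ht hW hj hD hθ (k + 1)
  have hEs := h.entropy_sub_le hχ ht hW (k + 1)
  have hK0 := h.integral_hessian_nonneg ht (χ (k + 1))
  have hKm : ∫ y, v y t * w y t * pdy L y t ^ 2 * χ (k + 1) y ^ 4 ≤
      ∫ y, v y t * w y t * pdy L y t ^ 2 :=
    hχ.integral_le (((h.smooth_v.mul h.smooth_w).mul
      ((h.smooth_L.pdy h.isOpen).pow 2)).continuous_fst ht)
      (fun y => mul_nonneg (mul_pos (hP.v_pos y) (hP.w_pos y)).le (sq_nonneg _))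
      (h.integrable_hessian hχ ht hW hj hD) (k + 1)
  have hEm : ∫ y, v y t * w y t * χ (k + 1) y ^ 4 ≤ ∫ y, v y t * w y t :=
    hχ.integral_le ((h.smooth_v.mul h.smooth_w).continuous_fst ht)
      (fun y => (mul_pos (hP.v_pos y) (hP.w_pos y)).le) (h.integrable_entropy ht hW) (k + 1)
  have hD0 : 0 ≤ D₁ := (integral_nonneg fun y => mul_nonneg (mul_nonneg (hP.v_pos y).le
    (sq_nonneg _)) (pow_nonneg ((hχ.scaled k).nonneg y) 4)).trans (hD k)
  rw [hE]
  have hj1 : 0 ≤ j₁ := hj0.trans hj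
  generalize (∫ y, v y t * w y t * pdy L y t ^ 2 * χ (k + 1) y ^ 4) = K' at *
  generalize (∫ y, v y t * w y t * pdy L y t ^ 2) = K at *
  generalize (∫ y, v y t * w y t * χ (k + 1) y ^ 4) = E' at *
  generalize (∫ y, v y t * w y t) = E at *
  generalize (∫ y, v y t * χ (k + 1) y ^ 4) = M' at *
  generalize (∫ y, v y t * χ k y ^ 4) = M at *
  generalize (∫ y, v y t * L y t ^ 2 * χ (k + 1) y ^ 4) = J' at *
  generalize 2 / J t = c at *
  generalize (1 / 2 : ℝ) ^ (k + 1 + 2) = σ at *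
  set K₁ := D₁ + (1 + 4 * B ^ 2 * W) * j₁ with hK₁
  have hK₁0 : 0 ≤ K₁ := by positivity
  have h1 : |K' - K| ≤ θ * (D₁ + 1 + 2 * (2 * K₁ + 2 * B ^ 2 * W * j₁)) := by
    rw [abs_sub_comm, abs_of_nonneg (by linarith)]
    calc _ ≤ θ * D₁ + θ⁻¹ * θ ^ 2 + 2 * θ * (2 * K₁ + 2 * B ^ 2 * W * j₁) := by
          refine hKs.trans ?_
          gcongr
      _ = _ := by field_simp
  have h2 : |r| ≤ θ * ((4 * p) * K₁ + ((4 * p * B ^ 2 * W) * j₁ + 128 * B ^ 4 * W ^ 3)) := by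
    refine hr.trans ?_
    gcongr
  have h3 : |E' - E| ≤ θ * W := by
    rw [abs_sub_comm, abs_of_nonneg (by linarith), mul_comm]
    refine hEs.trans ?_
    gcongr
  have h4 : |d| ≤ θ * (8 * B * W) := by
    rw [mul_comm θ]
    refine hd.trans ?_
    gcongr
  calc _ = |-(c * p) * ((p - 1) * (K' - K) + r) + κ * ((p - 1) * (E' - E) - d)| := by
        congr 1; ring
    _ ≤ c * p * ((p - 1) * |K' - K| + |r|) + κ * ((p - 1) * |E' - E| + |d|) := by
        refine (abs_add_le _ _).trans ?_
        rw [abs_mul, abs_mul, abs_neg, abs_of_nonneg hκ, abs_of_nonneg (by positivity : 0 ≤ c * p)]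
        gcongr
        · refine (abs_add_le _ _).trans ?_
          rw [abs_mul, abs_of_pos he]
        · refine (abs_sub _ _).trans ?_
          rw [abs_mul, abs_of_pos he]
    _ ≤ c₁ * p * ((p - 1) * (θ * (D₁ + 1 + 2 * (2 * K₁ + 2 * B ^ 2 * W * j₁))) +
        θ * ((4 * p) * K₁ + ((4 * p * B ^ 2 * W) * j₁ + 128 * B ^ 4 * W ^ 3))) +
        κ * ((p - 1) * (θ * W) + θ * (8 * B * W)) := by gcongr
    _ = _ := by ring

end PressureFlow

theorem PressureFlow.hasDerivAt_entropy {p κ B : ℝ} {s : Set ℝ} {v w L : ℝ → ℝ → ℝ} {J : ℝ → ℝ}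
    {χ e₁ e₂ : ℕ → ℝ → ℝ} (h : PressureFlow p κ s v w L J) (hχ : CutoffSequence B χ e₁ e₂) {τ : ℝ} (hτ : τ ∈ s) :
    HasDerivAt (fun t => ∫ y, v y t * w y t)
      (-(2 / J τ * p) * ((p - 1) * ∫ y, v y τ * w y τ * pdy L y τ ^ 2) +
        κ * ((p - 1) * ∫ y, v y τ * w y τ)) τ := by
  obtain ⟨W, j₁, c₁, D₁, hev⟩ := h.eventually_entropyProduction_le hχ hτ
  refine hasDerivAt_of_tendstoUniformlyOnFilter (l := (atTop : Filter ℕ))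
    (f := fun k t => ∫ y, v y t * w y t * χ (k + 1) y ^ 4)
    (f' := fun k t => ∫ y, p * w y t * pdt v y t * χ (k + 1) y ^ 4)
    (g := fun t => ∫ y, v y t * w y t)
    (g' := fun t => -(2 / J t * p) * ((p - 1) * ∫ y, v y t * w y t * pdy L y t ^ 2) +
        κ * ((p - 1) * ∫ y, v y t * w y t)) ?_ ?_ ?_
  · rw [Metric.tendstoUniformlyOnFilter_iff]
    intro ε hε
    set A := c₁ * p * ((p - 1) * (D₁ + 1 + 2 * (2 * (D₁ + (1 + 4 * B ^ 2 * W) * j₁) +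
        2 * B ^ 2 * W * j₁)) + ((4 * p) * (D₁ + (1 + 4 * B ^ 2 * W) * j₁) +
        ((4 * p * B ^ 2 * W) * j₁ + 128 * B ^ 4 * W ^ 3))) +
      κ * ((p - 1) * W + 8 * B * W) with hA
    obtain ⟨θ, hθ, hθA⟩ : ∃ θ : ℝ, 0 < θ ∧ θ * A < ε := by
      refine ⟨ε / (|A| + 1), by positivity, ?_⟩
      rw [div_mul_eq_mul_div, div_lt_iff₀ (by positivity)]
      gcongr
      linarith [le_abs_self A]
    obtain ⟨m, hm⟩ := h.exists_tail_le hχ h.smooth_v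
      (fun y t ht => ((h.profile t ht).v_pos y).le) h.integrable_v hτ
      ((continuousAt_const (y := (1 : ℝ))).congr (by
        filter_upwards [h.isOpen.mem_nhds hτ] with t ht
        exact (h.integral_v t ht).symm)) hθ
    obtain ⟨n, hn⟩ := h.exists_tail_le hχ (h.smooth_v.mul (h.smooth_L.pow 2))
      (fun y t ht => mul_nonneg ((h.profile t ht).v_pos y).le (sq_nonneg _)) h.integrable_sq hτ
      ((h.contDiffAt_fisher hχ hτ).continuousAt.congr (by
        filter_upwards [h.isOpen.mem_nhds hτ] with t ht
        exact (h.integral_sq t ht).symm)) (pow_pos hθ 2)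
    have hσ : ∀ᶠ k : ℕ in atTop, (1 / 2 : ℝ) ^ (k + 1 + 2) < θ :=
      (tendsto_half_pow_add_two.comp (tendsto_add_atTop_nat 1)).eventually (gt_mem_nhds hθ)
    have hk := ((eventually_ge_atTop m).and (eventually_ge_atTop n)).and hσ
    filter_upwards [hk.prod_mk (hev.and (hm.and hn))] with x hx
    obtain ⟨⟨⟨hxm, hxn⟩, hxσ⟩, ⟨hs, hW, hj, hc, hD⟩, hm', hn'⟩ := hx
    rw [h.integral_v _ hs] at hm'
    rw [h.integral_sq _ hs] at hn'
    rw [dist_comm, Real.dist_eq]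
    exact (h.abs_entropy_rate_sub_le hχ hs hW hj hD hc hθ hxσ.le (hn' _ (by lia)) (hm' _ hxm)
      (hm' _ (by lia))).trans_lt hθA
  · filter_upwards [(Eventually.of_forall fun _ => trivial : ∀ᶠ k : ℕ in atTop, True).prod_mk
      (h.isOpen.mem_nhds hτ : ∀ᶠ t in nhds τ, t ∈ s)] with x hx
    exact h.hasDerivAt_integral_entropy (hχ.scaled _) (hχ.contDiff _) hx.2
  · filter_upwards [hev] with t ht
    exact (hχ.tendsto_integral ((h.smooth_v.mul h.smooth_w).continuous_fst ht.1)
      (h.integrable_entropy ht.1 ht.2.1)).comp (tendsto_add_atTop_nat 1)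

lemma lnp_of_ne_one {p : ℝ} (hp : p ≠ 1) (u : ℝ) : lnp p u = (u ^ (p - 1) - 1) / (p - 1) :=
  if_neg hp

lemma rpow_eq_mul_rpow_sub_one {u : ℝ} (hu : 0 < u) (p : ℝ) : u ^ p = u * u ^ (p - 1) := by
  rw [Real.rpow_sub_one hu.ne', mul_div_cancel₀ _ hu.ne']

lemma hasDerivAt_lnp {p : ℝ} (hp : p ≠ 1) {f : ℝ → ℝ} {f' x : ℝ} (hf : HasDerivAt f f' x)
    (hx : 0 < f x) : HasDerivAt (fun y => lnp p (f y)) (f x ^ (p - 1) * f' / f x) x := by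
  have hp' : p - 1 ≠ 0 := sub_ne_zero.2 hp
  simp only [lnp_of_ne_one hp]
  refine (((hf.rpow_const (p := p - 1) (Or.inl hx.ne')).sub_const 1).div_const
    (p - 1)).congr_deriv ?_
  rw [Real.rpow_sub_one hx.ne' (p - 1)]
  field_simp

lemma pressureFlow_of_solution {p Θ₀ T : ℝ} (hp : 1 < p) (hΘ₀ : 0 < Θ₀) {v : ℝ → ℝ → ℝ}
    (hsmooth : ContDiffOn ℝ (⊤ : ℕ∞) (Function.uncurry v) (univ ×ˢ Ioo 0 T))
    (hpos : ∀ y τ, τ ∈ Ioo 0 T → 0 < v y τ)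
    (hpde : ∀ y τ, τ ∈ Ioo 0 T →
      deriv (fun s => v y s) τ =
        -(1 / fisherP p (fun z => v z τ)) *
            deriv (deriv (fun z =>
              (v z τ) ^ p * deriv (deriv (fun w => lnp p (v w τ))) z)) y
        + (2 * p / Θ₀) * deriv (fun z => z * v z τ) y)
    (hdens : ∀ τ ∈ Ioo 0 T, Integrable (fun y => v y τ) ∧ (∫ y : ℝ, v y τ) = 1)
    (hdecay : ∀ τ ∈ Ioo 0 T, RapidDecay (fun y => v y τ))
    (hI : ∀ τ ∈ Ioo 0 T, 0 < fisherP p (fun y => v y τ)) :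
    PressureFlow p (2 * p / Θ₀) (Ioo 0 T) v (fun y τ => v y τ ^ (p - 1))
      (pdy fun y τ => lnp p (v y τ)) (fun τ => 2 * fisherP p fun y => v y τ) := by
  have hv : SmoothStrip (Ioo 0 T) v := hsmooth
  have hs : IsOpen (Ioo 0 T) := isOpen_Ioo
  have hp0 : 0 < p - 1 := sub_pos.2 hp
  have hw : SmoothStrip (Ioo 0 T) fun y τ => v y τ ^ (p - 1) :=
    hv.rpow_const (fun y τ hτ => hpos y τ hτ) (p - 1)
  have hl : SmoothStrip (Ioo 0 T) fun y τ => lnp p (v y τ) := by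
    simp only [lnp_of_ne_one hp.ne']
    exact ContDiffOn.div_const (ContDiffOn.sub hw contDiffOn_const) _
  have hL := hl.pdy hs
  set L := pdy fun y τ => lnp p (v y τ) with hLdef
  have hwpos : ∀ y, ∀ τ ∈ Ioo 0 T, 0 < v y τ ^ (p - 1) := fun y τ hτ =>
    Real.rpow_pos_of_pos (hpos y τ hτ) _
  have hLv : ∀ y, ∀ τ ∈ Ioo 0 T, L y τ = v y τ ^ (p - 1) * pdy v y τ / v y τ := fun y τ hτ =>
    (hasDerivAt_lnp hp.ne' (hv.hasDerivAt_pdy hs y hτ) (hpos y τ hτ)).deriv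
  have hvL : ∀ y, ∀ τ ∈ Ioo 0 T, pdy v y τ = v y τ * L y τ / v y τ ^ (p - 1) := fun y τ hτ => by
    have h1 := (hpos y τ hτ).ne'
    have h2 := (hwpos y τ hτ).ne'
    rw [hLv y τ hτ]
    field_simp
  have hdw : ∀ {f : ℝ → ℝ} {f' x : ℝ}, HasDerivAt f f' x → 0 < f x →
      HasDerivAt (fun y => f y ^ (p - 1)) ((p - 1) * (f x ^ (p - 1) * f' / f x)) x :=
    fun {f f' x} hf hx => by
      refine (hf.rpow_const (p := p - 1) (Or.inl hx.ne')).congr_deriv ?_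
      rw [Real.rpow_sub_one hx.ne' (p - 1)]
      field_simp
  have hlt : ∀ y, ∀ τ ∈ Ioo 0 T, pdt (fun y τ => lnp p (v y τ)) y τ =
      v y τ ^ (p - 1) * pdt v y τ / v y τ := fun y τ hτ =>
    (hasDerivAt_lnp hp.ne' (hv.hasDerivAt_pdt hs y hτ) (hpos y τ hτ)).deriv
  have hprof : ∀ τ ∈ Ioo 0 T, PressureProfile p (fun y => v y τ) (fun y => v y τ ^ (p - 1))
      (fun y => L y τ) (fun y => pdy L y τ) (fun y => pdy (pdy L) y τ) := fun τ hτ =>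
    { one_lt := hp
      v_pos := fun y => hpos y τ hτ
      w_pos := fun y => hwpos y τ hτ
      hasDerivAt_v := fun y => (hv.hasDerivAt_pdy hs y hτ).congr_deriv (hvL y τ hτ)
      hasDerivAt_w := fun y => (hdw (hv.hasDerivAt_pdy hs y hτ) (hpos y τ hτ)).congr_deriv
        (by rw [hLv y τ hτ])
      hasDerivAt_L := fun y => hL.hasDerivAt_pdy hs y hτ
      hasDerivAt_L₂ := fun y => (hL.pdy hs).hasDerivAt_pdy hs y hτ
      continuous_L₃ := ((hL.pdy hs).pdy hs).continuous_fst hτ }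
  have hsq : ∀ τ ∈ Ioo 0 T, ∫ y, v y τ * L y τ ^ 2 = 2 * fisherP p fun y => v y τ :=
    fun τ hτ => by
      change _ = 2 * (1 / 2 * ∫ y, v y τ * L y τ ^ 2)
      ring
  have hisq : ∀ τ ∈ Ioo 0 T, Integrable fun y => v y τ * L y τ ^ 2 := fun τ hτ => by
    by_contra hn
    have h1 := hsq τ hτ
    rw [integral_undef hn] at h1
    linarith [hI τ hτ]
  refine
    { isOpen := hs
      smooth_v := hv
      smooth_w := hw
      smooth_L := hL
      drift_nonneg := by positivity
      profile := hprof
      pdt_w := fun y τ hτ => ?_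
      pdt_L := fun y τ hτ => ?_
      pde := fun y τ hτ => ?_
      integrable_v := fun τ hτ => (hdens τ hτ).1
      integral_v := fun τ hτ => (hdens τ hτ).2
      integrable_sq := hisq
      integral_sq := hsq
      fisher_pos := fun τ hτ => mul_pos two_pos (hI τ hτ)
      weight_le := fun τ hτ y => ?_ }
  · refine (hdw (hv.hasDerivAt_pdt hs y hτ) (hpos y τ hτ)).deriv.trans ?_
    ring
  · rw [hLdef, hl.pdt_pdy hs y hτ]
    exact congrArg (fun f => deriv f y) (funext fun z => hlt z τ hτ)
  · have h1 : deriv (fun z => z * v z τ) y =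
        v y τ + y * (v y τ * L y τ / v y τ ^ (p - 1)) := by
      refine ((hasDerivAt_id y).mul (hv.hasDerivAt_pdy hs y hτ)).deriv.trans ?_
      rw [hvL y τ hτ, id, one_mul]
    have h2 : (fun z => (v z τ) ^ p * deriv (deriv (fun w => lnp p (v w τ))) z) =
        fun z => v z τ * v z τ ^ (p - 1) * pdy L z τ := funext fun z => by
      rw [rpow_eq_mul_rpow_sub_one (hpos z τ hτ) p]
      rfl
    have h3 := hpde y τ hτ
    rw [h1, h2] at h3
    refine h3.trans ?_
    congr 1
    rw [neg_mul]
    congr 2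
    have := (hI τ hτ).ne'
    field_simp
  · have hp' : p ≠ 0 := by linarith
    have h0 : Tendsto (fun y => v y τ) atBot (nhds 0) := by
      have := (hdecay τ hτ 0 0).mono_left atBot_le_cocompact
      simpa using this
    have h1 : Tendsto (fun y => v y τ * v y τ ^ (p - 1)) atBot (nhds 0) := by
      have := h0.rpow_const (p := p) (Or.inr (by linarith))
      rw [Real.zero_rpow hp'] at this
      exact this.congr fun y => rpow_eq_mul_rpow_sub_one (hpos y τ hτ) p
    have h2 := (hprof τ hτ).mul_le_of_tendsto (hdens τ hτ).1 (hisq τ hτ) h1 y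
    rw [(hdens τ hτ).2, hsq τ hτ] at h2
    have h3 := hwpos y τ hτ
    have h4 := hpos y τ hτ
    rcases le_total (v y τ) 1 with h5 | h5
    · have h6 := Real.rpow_le_one h4.le h5 hp0.le
      nlinarith [mul_pos h4 h3]
    · nlinarith

/-- along smooth positive rapidly decaying solutions of the nonlocal
rescaled equation, the relative Rényi entropy with respect to any fixed density `B`
evolves by `(d/dτ)[R_p(B) − R_p(v)] = −(p/(∫ v^p · I_p(v))) K_p(v) + 2p/Θ₀`. -/
theorem relative_renyi_evolution
    (p Θ₀ T : ℝ) (hp : 1 < p) (hΘ₀ : 0 < Θ₀) (hT : 0 < T)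
    (v : ℝ → ℝ → ℝ)
    (hsmooth : ContDiffOn ℝ (⊤ : ℕ∞) (Function.uncurry v) (univ ×ˢ Ioo 0 T))
    (hpos : ∀ y τ, τ ∈ Ioo 0 T → 0 < v y τ)
    (hpde : ∀ y τ, τ ∈ Ioo 0 T →
      deriv (fun s => v y s) τ =
        -(1 / fisherP p (fun z => v z τ)) *
            deriv (deriv (fun z =>
              (v z τ) ^ p * deriv (deriv (fun w => lnp p (v w τ))) z)) y
        + (2 * p / Θ₀) * deriv (fun z => z * v z τ) y)
    (hdens : ∀ τ ∈ Ioo 0 T,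
      Integrable (fun y => v y τ) ∧ (∫ y : ℝ, v y τ) = 1)
    (hdecay : ∀ τ ∈ Ioo 0 T, RapidDecay (fun y => v y τ))
    (hI : ∀ τ ∈ Ioo 0 T, 0 < fisherP p (fun y => v y τ))
    (hvp : ∀ τ ∈ Ioo 0 T,
      Integrable (fun y => v y τ ^ p) ∧ 0 < ∫ y : ℝ, v y τ ^ p)
    (B : ℝ → ℝ) (hB0 : ∀ y, 0 ≤ B y)
    (hBint : Integrable B) (hBmass : (∫ y : ℝ, B y) = 1)
    (hBp : Integrable (fun y => B y ^ p) ∧ 0 < ∫ y : ℝ, B y ^ p) :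
    ∀ τ ∈ Ioo 0 T,
      HasDerivAt (fun s => renyi p B - renyi p (fun y => v y s))
        (-(p / ((∫ y : ℝ, v y τ ^ p) * fisherP p (fun y => v y τ))) *
            (∫ y : ℝ, v y τ ^ p * (deriv (deriv (fun z => lnp p (v z τ))) y) ^ 2)
          + 2 * p / Θ₀) τ := by
  intro τ hτ
  have hflow := pressureFlow_of_solution hp hΘ₀ hsmooth hpos hpde hdens hdecay hI
  obtain ⟨b, χ, e₁, e₂, hχ⟩ := exists_cutoffSequence
  have hmul : ∀ t ∈ Ioo 0 T, ∀ y, v y t ^ p = v y t * v y t ^ (p - 1) := fun t ht y =>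
    rpow_eq_mul_rpow_sub_one (hpos y t ht) p
  have hE := (hflow.hasDerivAt_entropy hχ hτ).congr_of_eventuallyEq
    (f₁ := fun t => ∫ y, v y t ^ p) (by
      filter_upwards [isOpen_Ioo.mem_nhds hτ] with t ht
      simp only [hmul t ht])
  have hEpos := (hvp τ hτ).2
  refine (((hE.log hEpos.ne').const_mul (1 / (1 - p))).const_sub (renyi p B)).congr_deriv ?_
  have hK : ∫ y, v y τ * v y τ ^ (p - 1) * pdy (pdy fun y τ => lnp p (v y τ)) y τ ^ 2 =
      ∫ y, v y τ ^ p * (deriv (deriv (fun z => lnp p (v z τ))) y) ^ 2 := by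
    simp only [hmul τ hτ]
    rfl
  have hEeq : ∫ y, v y τ * v y τ ^ (p - 1) = ∫ y, v y τ ^ p := by simp only [hmul τ hτ]
  rw [hK, hEeq]
  have h1 := (hI τ hτ).ne'
  have h2 := hEpos.ne'
  have h3 : 1 - p ≠ 0 := by linarith
  field_simp
  ring
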